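/- arXiv:0912.2829 — 5 statements merged into one kernel-verified Lean document; each statement's English description precedes it below -/
import Mathlib

section
/- Let E|F be a cyclic extension of degree p inside Ω, and let a ∈ K^× and x ∈ Ω be such that x^p = a and E(ζ) = K(x), so that the class ā of a spans the 𝔽_p-line D ⊂ K^×/(K^×)^p corresponding to the cyclic degree-p extension E(ζ)|K. Then D is stable under the action of Δ, and Δ acts on D via the cyclotomic character ω; explicitly, for every σ ∈ Δ one has σ(a)·a^{−ω(σ)} ∈ (K^×)^p. -/
open IntermediateField

/-- An element of a normal extension which is fixed by all automorphisms and has a power of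
invertible exponent in the base field lies in the base field. -/
theorem mem_bot_of_pow_mem_of_forall_fixed {K L : Type*} [Field K] [Field L] [Algebra K L]
    [Normal K L] {n : ℕ} (hn : (n : K) ≠ 0) {y : L} {b : K} (hb : b ≠ 0)
    (hy : y ^ n = algebraMap K L b) (hfix : ∀ τ : L ≃ₐ[K] L, τ y = y) :
    y ∈ (⊥ : Subalgebra K L) := by
  have hsep : IsSeparable K y := by
    refine (Polynomial.separable_X_pow_sub_C b hn hb).of_dvd (minpoly.dvd K y ?_)
    simp [hy]
  by_contra h
  obtain ⟨z, hne, hz⟩ :=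
    (notMem_iff_exists_ne_and_isConjRoot hsep (Normal.splits inferInstance y)).1 h
  obtain ⟨τ, hτ⟩ := (isConjRoot_iff_exists_algEquiv).1 hz
  exact hne (τ.injective ((hfix τ).trans hτ.symm))

/-- Two automorphisms commute on the compositum of a normal subextension with commutative
automorphism group and a subfield on which they commute. -/
theorem algEquiv_comm_apply_of_mem_sup {F L : Type*} [Field F] [Field L] [Algebra F L]
    (E K : IntermediateField F L) [Normal F E] (hE : ∀ f g : E ≃ₐ[F] E, f * g = g * f)
    (s t : L ≃ₐ[F] L) (hK : ∀ z ∈ K, s (t z) = t (s z)) {x : L} (hx : x ∈ E ⊔ K) :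
    s (t x) = t (s x) := by
  have hle : E ⊔ K ≤ fixedField (Subgroup.zpowers ((t * s)⁻¹ * (s * t))) := by
    rw [le_iff_le, Subgroup.zpowers_le, fixingSubgroup_sup, Subgroup.mem_inf]
    constructor <;> rw [IntermediateField.mem_fixingSubgroup_iff] <;>
      simp only [AlgEquiv.mul_apply]
    · intro z hz
      have h := congrArg (fun f : E ≃ₐ[F] E => (f ⟨z, hz⟩ : L))
        (hE (s.restrictNormal E) (t.restrictNormal E))
      have hs (w : E) : (s.restrictNormal E w : L) = s w := s.restrictNormal_commutes E w
      have ht (w : E) : (t.restrictNormal E w : L) = t w := t.restrictNormal_commutes E w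
      simp only [AlgEquiv.mul_apply, hs, ht] at h
      rw [h]
      exact (t * s).symm_apply_apply z
    · intro z hz
      rw [hK z hz]
      exact (t * s).symm_apply_apply z
  have h := (mem_fixedField_iff _ _).1 (hle hx) _ (Subgroup.mem_zpowers _)
  have h' := congrArg (t * s) h
  rw [← AlgEquiv.mul_apply, mul_inv_cancel_left] at h'
  exact h'

/-- Let `p` be a prime, `F` a field in which `p` is invertible, `Ω` an algebraic closure of
`F`, `ζ ∈ Ω` a primitive `p`-th root of unity, `K = F(ζ)`, `Δ = Gal(K|F)` and
`ω : Δ → (ℤ/pℤ)ˣ` the mod-`p` cyclotomic character (`σ ζ = ζ ^ ω σ`).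

Let `E|F` be a cyclic extension of degree `p` inside `Ω`, and let `a ∈ Kˣ` and `x ∈ Ω` be
such that `x ^ p = a` and `E(ζ) = K(x)`, so that the class of `a` spans the `𝔽_p`-line
`D ⊆ Kˣ/(Kˣ)ᵖ` corresponding to the cyclic degree-`p` extension `E(ζ)|K`.  Then `D` is
`Δ`-stable and `Δ` acts on `D` via `ω`: for every `σ ∈ Δ` one has
`σ(a)·a^{−ω(σ)} ∈ (Kˣ)ᵖ`. -/
theorem statement0 (p : ℕ) (hp : p.Prime)
    (F : Type*) [Field F] (hpF : (p : F) ≠ 0)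
    (Ω : Type*) [Field Ω] [Algebra F Ω] [IsAlgClosure F Ω]
    (ζ : Ω) (hζ : IsPrimitiveRoot ζ p)
    (ω : (↥(adjoin F {ζ}) ≃ₐ[F] ↥(adjoin F {ζ})) → (ZMod p)ˣ)
    (hω : ∀ σ : ↥(adjoin F {ζ}) ≃ₐ[F] ↥(adjoin F {ζ}),
      ((σ ⟨ζ, mem_adjoin_simple_self F ζ⟩ : ↥(adjoin F {ζ})) : Ω) = ζ ^ (ω σ : ZMod p).val)
    (E : IntermediateField F Ω) (hEgal : IsGalois F ↥E)
    (hEcyc : IsCyclic (↥E ≃ₐ[F] ↥E)) (hEdeg : Module.finrank F ↥E = p)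
    (a : (↥(adjoin F {ζ}))ˣ) (x : Ω)
    (hx : x ^ p = ((a : ↥(adjoin F {ζ})) : Ω))
    (hEK : E ⊔ adjoin F {ζ} = adjoin F {ζ} ⊔ adjoin F {x}) :
    ∀ σ : ↥(adjoin F {ζ}) ≃ₐ[F] ↥(adjoin F {ζ}),
      ∃ y : (↥(adjoin F {ζ}))ˣ,
        Units.map (σ : ↥(adjoin F {ζ}) →* ↥(adjoin F {ζ})) a
          = a ^ (ω σ : ZMod p).val * y ^ p := by
  intro σ
  have : IsAlgClosed Ω := IsAlgClosure.isAlgClosed F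
  have : Normal F Ω := IsAlgClosure.normal F Ω
  have : NeZero p := ⟨hp.ne_zero⟩
  let K := adjoin F {ζ}
  have hζK : ζ ∈ K := mem_adjoin_simple_self F ζ
  let s : Ω ≃ₐ[F] Ω := σ.liftNormal Ω
  have hs (w : K) : s w = σ w := σ.liftNormal_commutes Ω w
  have hsζ : s ζ = ζ ^ (ω σ : ZMod p).val := (hs ⟨ζ, hζK⟩).trans (hω σ)
  set w := (ω σ : ZMod p).val
  have hx0 : x ≠ 0 := by
    rintro rfl
    rw [zero_pow hp.ne_zero] at hx
    exact a.ne_zero (Subtype.ext hx.symm)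
  have hxsup : x ∈ E ⊔ K := by
    rw [hEK]
    exact (le_sup_right : adjoin F {x} ≤ _) (mem_adjoin_simple_self F x)
  let b : Kˣ := Units.map (σ : K →* K) a / a ^ w
  have hb : (s x / x ^ w) ^ p = algebraMap K Ω b := by
    have h1 : s x ^ p = σ a := by rw [← map_pow, hx, hs]
    rw [div_pow, h1, ← pow_mul, mul_comm, pow_mul, hx]
    simp [b]
  have hfix (τ : Ω ≃ₐ[K] Ω) : τ (s x / x ^ w) = s x / x ^ w := by
    have hτK (z : Ω) (hz : z ∈ K) : τ z = z := τ.commutes ⟨z, hz⟩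
    have hcomm : s (τ x) = τ (s x) :=
      algEquiv_comm_apply_of_mem_sup E K
        (fun f g => (IsCyclic.commGroup (α := E ≃ₐ[F] E)).mul_comm f g)
        s (τ.restrictScalars F) (fun z hz => by
          have h : s z = σ ⟨z, hz⟩ := hs ⟨z, hz⟩
          simp only [AlgEquiv.restrictScalars_apply]
          rw [hτK z hz, h, hτK _ (σ ⟨z, hz⟩).2]) hxsup
    obtain ⟨i, -, hi⟩ := hζ.eq_pow_of_pow_eq_one (ξ := τ x / x) (by
      rw [div_pow, ← map_pow, hx, hτK _ (a : K).2]
      exact div_self (by rw [← hx]; exact pow_ne_zero _ hx0))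
    have hτx : τ x = ζ ^ i * x := by rw [hi, div_mul_cancel₀ _ hx0]
    have hζ0 : ζ ≠ 0 := hζ.ne_zero hp.ne_zero
    rw [map_div₀, map_pow, ← hcomm, hτx, map_mul, map_pow, hsζ, mul_pow, ← pow_mul, ← pow_mul,
      mul_comm w i, mul_div_mul_left _ _ (pow_ne_zero _ hζ0)]
  have hpK : (p : K) ≠ 0 := by
    rw [← map_natCast (algebraMap F K)]
    exact (map_ne_zero _).2 hpF
  have : Normal K Ω := Normal.tower_top_of_normal F K Ω
  obtain ⟨y, hy⟩ := Algebra.mem_bot.1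
    (mem_bot_of_pow_mem_of_forall_fixed hpK b.ne_zero hb hfix)
  have hyp : y ^ p = b := (algebraMap K Ω).injective (by rw [map_pow, hy, hb])
  have hy0 : y ≠ 0 := by
    rintro rfl
    rw [zero_pow hp.ne_zero] at hyp
    exact b.ne_zero hyp.symm
  refine ⟨Units.mk0 y hy0, ?_⟩
  have hyb : Units.mk0 y hy0 ^ p = b := Units.ext (by simpa using hyp)
  rw [hyb, mul_div_cancel]
end

section
/- Let a ∈ K^× be an element whose class modulo (K^×)^p is nonzero and satisfies σ(a)·a^{−ω(σ)} ∈ (K^×)^p for every σ ∈ Δ (i.e. the 𝔽_p-line D spanned by the class of a is Δ-stable with Δ acting via ω), and let x ∈ Ω satisfy x^p = a. Then K(x)|F is an abelian Galois extension, and there exists a unique cyclic extension E|F of degree p inside Ω such that K(x) = E(ζ). -/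
open IntermediateField

/-- A Kummer extension `F(ζ, x) / F` on which every automorphism acts by the same power on `ζ` and,
up to a factor in `F(ζ)`, on `x`, has commutative automorphism group. -/
theorem AlgEquiv.isMulCommutative_of_kummer {F L : Type*} [Field F] [Field L] [Algebra F L] {p : ℕ}
    (hp : p.Prime) {ζ x : L} (hζ : IsPrimitiveRoot ζ p) (hx : x ≠ 0)
    (htop : F⟮ζ⟯ ⊔ F⟮x⟯ = ⊤) (hxp : x ^ p ∈ F⟮ζ⟯)
    (h : ∀ σ : L ≃ₐ[F] L, ∃ m : ℕ, ∃ u ∈ F⟮ζ⟯, σ ζ = ζ ^ m ∧ σ x = x ^ m * u) :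
    IsMulCommutative (L ≃ₐ[F] L) := by
  have : Fact p.Prime := ⟨hp⟩
  refine (hζ.autToPow F).isMulCommutative_of_isCyclic_of_ker_le_center fun τ hτ => ?_
  have hτζ : τ ζ = ζ := by
    rw [← hζ.autToPow_spec F τ, MonoidHom.mem_ker.mp hτ, Units.val_one, ZMod.val_one, pow_one]
  have hfix : ∀ u ∈ F⟮ζ⟯, τ u = u := fun u hu => by
    have : F⟮ζ⟯ ≤ fixedField (Subgroup.zpowers τ) :=
      adjoin_simple_le_iff.mpr fun ⟨g, hg⟩ =>
        (Subgroup.zpowers_le (H := MulAction.stabilizer (L ≃ₐ[F] L) ζ)).mpr hτζ hg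
    exact this hu ⟨τ, Subgroup.mem_zpowers τ⟩
  obtain ⟨i, -, hi⟩ := hζ.eq_pow_of_pow_eq_one (ξ := τ x / x) (by
    rw [div_pow, ← map_pow, hfix _ hxp, div_self (pow_ne_zero _ hx)])
  rw [eq_div_iff hx] at hi
  rw [Subgroup.mem_center_iff]
  intro σ
  obtain ⟨m, u, hu, hσζ, hσx⟩ := h σ
  have hgen :
      (⊤ : IntermediateField F L) ≤ fixedField (Subgroup.zpowers ((τ * σ)⁻¹ * (σ * τ))) := by
    rw [← htop, sup_le_iff, adjoin_simple_le_iff, adjoin_simple_le_iff]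
    refine ⟨fun ⟨g, hg⟩ => (Subgroup.zpowers_le (H := MulAction.stabilizer (L ≃ₐ[F] L) ζ)).mpr ?_ hg,
      fun ⟨g, hg⟩ => (Subgroup.zpowers_le (H := MulAction.stabilizer (L ≃ₐ[F] L) x)).mpr ?_ hg⟩
    · rw [MulAction.mem_stabilizer_iff, mul_smul, inv_smul_eq_iff]
      simp [AlgEquiv.mul_apply, hτζ, hσζ]
    · rw [MulAction.mem_stabilizer_iff, mul_smul, inv_smul_eq_iff]
      simp only [AlgEquiv.smul_def, AlgEquiv.mul_apply, ← hi, hσx, map_mul, map_pow, hσζ, hfix u hu]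
      ring
  symm
  rw [← inv_mul_eq_one]
  ext y
  have := hgen (mem_top (x := y)) ⟨_, Subgroup.mem_zpowers _⟩
  simpa [Subgroup.smul_def, mul_assoc] using this

/-- In a finite commutative group, a subgroup whose order is coprime to its index is determined by
its index. -/
theorem Subgroup.eq_of_index_eq_of_coprime {G : Type*} [CommGroup G] [Finite G]
    {M N : Subgroup G} (h : M.index = N.index) (hN : (Nat.card N).Coprime N.index) : M = N := by
  have hcard : Nat.card M = Nat.card N :=
    Nat.eq_of_mul_eq_mul_right (Nat.pos_of_ne_zero N.index_ne_zero_of_finite)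
      (by rw [N.card_mul_index, ← h, M.card_mul_index])
  refine Subgroup.eq_of_le_of_card_ge (fun g hg => ?_) hcard.ge
  have h1 : g ^ Nat.card N = 1 := by
    rw [← hcard]
    exact congrArg Subtype.val (pow_card_eq_one' (x := (⟨g, hg⟩ : M)))
  have h2 : orderOf (QuotientGroup.mk (s := N) g) ∣ 1 := by
    rw [← hN]
    refine Nat.dvd_gcd (orderOf_dvd_of_pow_eq_one ?_) (orderOf_dvd_of_pow_eq_one ?_)
    · rw [← QuotientGroup.mk_pow, h1, QuotientGroup.mk_one]
    · rw [← QuotientGroup.mk_pow, QuotientGroup.eq_one_iff]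
      exact N.pow_index_mem g
  rwa [Nat.dvd_one, orderOf_eq_one_iff, QuotientGroup.eq_one_iff] at h2

/-- In an abelian extension `L / F`, if `[K : F]` and `[L : K]` are coprime, there is a unique
intermediate field of degree `[L : K]` over `F`. -/
theorem IntermediateField.existsUnique_finrank_eq_of_coprime {F L : Type*} [Field F] [Field L]
    [Algebra F L] [FiniteDimensional F L] [IsAbelianGalois F L] (K : IntermediateField F L)
    (h : (Module.finrank F K).Coprime (Module.finrank K L)) :
    ∃! E : IntermediateField F L, Module.finrank F E = Module.finrank K L := by
  let _ : CommGroup (L ≃ₐ[F] L) := { mul_comm := mul_comm' }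
  rw [finrank_eq_fixingSubgroup_index, ← IsGalois.card_fixingSubgroup_eq_finrank] at h
  obtain ⟨C, hC⟩ := Subgroup.exists_right_complement'_of_coprime h.symm
  have hE : C.index = Module.finrank K L := by
    rw [← IsGalois.card_fixingSubgroup_eq_finrank]; exact hC.index_eq_card
  refine ⟨fixedField C, ?_, fun E hE' => ?_⟩
  · beta_reduce
    rw [finrank_eq_fixingSubgroup_index, fixingSubgroup_fixedField, hE]
  · rw [← IsGalois.fixedField_fixingSubgroup E]
    congr 1
    refine Subgroup.eq_of_index_eq_of_coprime ?_ ?_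
    · rw [← finrank_eq_fixingSubgroup_index, hE', hE]
    · rwa [hC.index_eq_card, ← hC.symm.index_eq_card]

theorem IntermediateField.finrank_adjoin_primitiveRoot_coprime {F Ω : Type*} [Field F] [Field Ω]
    [Algebra F Ω] {p : ℕ} (hp : p.Prime) {ζ : Ω} (hζ : IsPrimitiveRoot ζ p) :
    (Module.finrank F F⟮ζ⟯).Coprime p := by
  have hint : IsIntegral F ζ := (hζ.isIntegral hp.pos).tower_top
  refine (Nat.coprime_of_lt_prime ?_ ?_ hp).symm
  · rw [adjoin.finrank hint]
    exact (minpoly.natDegree_pos hint).ne'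
  · rw [adjoin.finrank hint]
    have hroot : Polynomial.aeval ζ (Polynomial.cyclotomic p F) = 0 := by
      rw [Polynomial.aeval_def, Polynomial.eval₂_eq_eval_map, Polynomial.map_cyclotomic]
      exact hζ.isRoot_cyclotomic hp.pos
    have hle := Polynomial.natDegree_le_natDegree
      (minpoly.min F ζ (Polynomial.cyclotomic.monic p F) hroot)
    rw [Polynomial.natDegree_cyclotomic, Nat.totient_prime hp] at hle
    exact hle.trans_lt (Nat.sub_lt hp.pos one_pos)

theorem IntermediateField.finrank_adjoin_sup_adjoin_of_pow {F Ω : Type*} [Field F] [Field Ω]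
    [Algebra F Ω] {p : ℕ} (hp : p.Prime) (K : IntermediateField F Ω) {x : Ω} {a : K}
    (ha : ∀ b : K, b ^ p ≠ a) (hx : x ^ p = a) :
    Module.finrank F ↥(K ⊔ F⟮x⟯) = Module.finrank F K * p := by
  have hirr := X_pow_sub_C_irreducible_of_prime hp ha
  have hint : IsIntegral K x := ⟨_, Polynomial.monic_X_pow_sub_C a hp.ne_zero, by simp [hx]⟩
  have hmin : Polynomial.X ^ p - Polynomial.C a = minpoly K x :=
    minpoly.eq_of_irreducible_of_monic hirr (by simp [hx])
      (Polynomial.monic_X_pow_sub_C a hp.ne_zero)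
  have hres : K⟮x⟯.restrictScalars F = K ⊔ F⟮x⟯ := by
    rw [restrictScalars_adjoin_eq_sup]
  rw [← hres]
  have h := Module.finrank_mul_finrank F K K⟮x⟯
  rw [adjoin.finrank hint, ← hmin, Polynomial.natDegree_X_pow_sub_C] at h
  exact h.symm

theorem IntermediateField.isGalois_of_kummer {F Ω : Type*} [Field F] [Field Ω] [Algebra F Ω]
    [Normal F Ω] {p : ℕ} (hpF : (p : F) ≠ 0) (K : IntermediateField F Ω) [IsGalois F K] {x : Ω}
    (hx : x ≠ 0) (hxp : x ^ p ∈ K)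
    (h : ∀ σ : Ω ≃ₐ[F] Ω, ∃ m : ℕ, ∃ u ∈ K, σ x = x ^ m * u) :
    IsGalois F ↥(K ⊔ F⟮x⟯) := by
  have hxL : x ∈ K ⊔ F⟮x⟯ := (le_sup_right : F⟮x⟯ ≤ K ⊔ F⟮x⟯) (mem_adjoin_simple_self F x)
  have hnormal : Normal F ↥(K ⊔ F⟮x⟯) := by
    rw [normal_iff_forall_map_le']
    intro σ
    rw [map_sup, sup_le_iff]
    refine ⟨(normal_iff_forall_map_le'.mp inferInstance σ).trans le_sup_left, ?_⟩
    rw [adjoin_map, Set.image_singleton, adjoin_simple_le_iff]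
    obtain ⟨m, u, hu, hσ⟩ := h σ
    change σ x ∈ _
    rw [hσ]
    exact mul_mem (pow_mem hxL m) ((le_sup_left : K ≤ K ⊔ F⟮x⟯) hu)
  have hsepx : IsSeparable K x := by
    have hpK : (p : K) ≠ 0 := by
      rw [← map_natCast (algebraMap F K)]
      exact (map_ne_zero _).mpr hpF
    have hsep := Polynomial.separable_X_pow_sub_C (⟨x ^ p, hxp⟩ : K) hpK
      (by simpa [Subtype.ext_iff] using pow_ne_zero p hx)
    exact hsep.of_dvd (minpoly.dvd K x (by simp [IntermediateField.algebraMap_apply]))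
  have hsep : Algebra.IsSeparable F ↥(K ⊔ F⟮x⟯) := by
    rw [← le_separableClosure_iff, sup_le_iff]
    refine ⟨le_separableClosure F Ω K, ?_⟩
    rw [adjoin_simple_le_iff, mem_separableClosure_iff]
    exact IsSeparable.of_algebra_isSeparable_of_isSeparable F hsepx
  exact { }

/-- Let `p` be a prime, `F` a field in which `p` is invertible, `Ω` an algebraic closure of
`F`, `ζ ∈ Ω` a primitive `p`-th root of unity, `K = F(ζ)`, `Δ = Gal(K|F)` and
`ω : Δ → (ℤ/pℤ)ˣ` the mod-`p` cyclotomic character (`σ ζ = ζ ^ ω σ`).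

Let `a ∈ Kˣ` be an element whose class modulo `(Kˣ)ᵖ` is nonzero and satisfies
`σ(a)·a^{−ω(σ)} ∈ (Kˣ)ᵖ` for every `σ ∈ Δ` (i.e. the `𝔽_p`-line spanned by the class of
`a` is `Δ`-stable with `Δ` acting via `ω`), and let `x ∈ Ω` satisfy `x ^ p = a`.  Then
`K(x)|F` is an abelian Galois extension, and there exists a unique cyclic extension `E|F`
of degree `p` inside `Ω` such that `K(x) = E(ζ)`. -/
theorem statement1 (p : ℕ) (hp : p.Prime)
    (F : Type*) [Field F] (hpF : (p : F) ≠ 0)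
    (Ω : Type*) [Field Ω] [Algebra F Ω] [IsAlgClosure F Ω]
    (ζ : Ω) (hζ : IsPrimitiveRoot ζ p)
    (ω : (↥(adjoin F {ζ}) ≃ₐ[F] ↥(adjoin F {ζ})) → (ZMod p)ˣ)
    (hω : ∀ σ : ↥(adjoin F {ζ}) ≃ₐ[F] ↥(adjoin F {ζ}),
      ((σ ⟨ζ, mem_adjoin_simple_self F ζ⟩ : ↥(adjoin F {ζ})) : Ω) = ζ ^ (ω σ : ZMod p).val)
    (a : (↥(adjoin F {ζ}))ˣ)
    (ha : ¬ ∃ y : (↥(adjoin F {ζ}))ˣ, a = y ^ p)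
    (haeig : ∀ σ : ↥(adjoin F {ζ}) ≃ₐ[F] ↥(adjoin F {ζ}),
      ∃ y : (↥(adjoin F {ζ}))ˣ,
        Units.map (σ : ↥(adjoin F {ζ}) →* ↥(adjoin F {ζ})) a
          = a ^ (ω σ : ZMod p).val * y ^ p)
    (x : Ω) (hx : x ^ p = ((a : ↥(adjoin F {ζ})) : Ω)) :
    (IsGalois F ↥(adjoin F {ζ} ⊔ adjoin F {x}) ∧
      ∀ σ τ : ↥(adjoin F {ζ} ⊔ adjoin F {x}) ≃ₐ[F] ↥(adjoin F {ζ} ⊔ adjoin F {x}),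
        σ * τ = τ * σ) ∧
    ∃! E : IntermediateField F Ω,
      IsGalois F ↥E ∧ IsCyclic (↥E ≃ₐ[F] ↥E) ∧ Module.finrank F ↥E = p ∧
        adjoin F {ζ} ⊔ adjoin F {x} = E ⊔ adjoin F {ζ} := by
  have : Fact p.Prime := ⟨hp⟩
  have hnormΩ : Normal F Ω := IsAlgClosure.normal F Ω
  have hcyc : IsCyclotomicExtension {p} F F⟮ζ⟯ := hζ.intermediateField_adjoin_isCyclotomicExtension F
  have hgalK : IsGalois F F⟮ζ⟯ := IsCyclotomicExtension.isGalois {p} F F⟮ζ⟯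
  have hfinK : FiniteDimensional F F⟮ζ⟯ := IsCyclotomicExtension.finiteDimensional {p} F F⟮ζ⟯
  have hx0 : x ≠ 0 := by
    rintro rfl
    rw [zero_pow hp.ne_zero] at hx
    exact a.ne_zero (Subtype.ext hx.symm)
  have hxp : x ^ p ∈ F⟮ζ⟯ := hx ▸ (a : F⟮ζ⟯).2
  have hact : ∀ σ : Ω ≃ₐ[F] Ω, ∃ m : ℕ, ∃ u ∈ F⟮ζ⟯, σ ζ = ζ ^ m ∧ σ x = x ^ m * u := by
    intro σ
    obtain ⟨y, hy⟩ := haeig (σ.restrictNormal F⟮ζ⟯)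
    have hσζ := hω (σ.restrictNormal F⟮ζ⟯)
    rw [AlgEquiv.restrictNormal_apply] at hσζ
    generalize (ω (σ.restrictNormal F⟮ζ⟯) : ZMod p).val = m at hy hσζ
    have hy' : σ a = a ^ m * y ^ p := by
      have := congrArg (fun z : (F⟮ζ⟯)ˣ => ((z : F⟮ζ⟯) : Ω)) hy
      simpa [AlgEquiv.restrictNormal_apply] using this
    have hxy : x ^ m * (y : F⟮ζ⟯) ≠ 0 := mul_ne_zero (pow_ne_zero m hx0) (by simp)
    obtain ⟨i, -, hi⟩ := hζ.eq_pow_of_pow_eq_one (ξ := σ x / (x ^ m * (y : F⟮ζ⟯))) (by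
      rw [div_pow, ← map_pow, hx, hy', mul_pow, ← pow_mul, mul_comm m p, pow_mul, hx, div_self]
      rw [← hx, ← pow_mul, mul_comm p m, pow_mul, ← mul_pow]
      exact pow_ne_zero p hxy)
    rw [eq_div_iff hxy] at hi
    refine ⟨m, ζ ^ i * (y : F⟮ζ⟯), mul_mem (pow_mem (mem_adjoin_simple_self F ζ) i) y.1.2, hσζ, ?_⟩
    rw [← hi]
    ring
  have hgal : IsGalois F ↥(F⟮ζ⟯ ⊔ F⟮x⟯) := isGalois_of_kummer hpF _ hx0 hxp fun σ =>
    (hact σ).imp fun m ⟨u, hu, h⟩ => ⟨u, hu, h.2⟩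
  have hrank : Module.finrank F ↥(F⟮ζ⟯ ⊔ F⟮x⟯) = Module.finrank F F⟮ζ⟯ * p := by
    refine finrank_adjoin_sup_adjoin_of_pow hp F⟮ζ⟯ (fun b hb => ha ?_) hx
    have hb0 : b ≠ 0 := by
      rintro rfl
      rw [zero_pow hp.ne_zero] at hb
      exact a.ne_zero hb.symm
    exact ⟨Units.mk0 b hb0, Units.ext (by simp [hb])⟩
  have hcop := finrank_adjoin_primitiveRoot_coprime (F := F) hp hζ
  set L := F⟮ζ⟯ ⊔ F⟮x⟯ with hL
  have hζL : ζ ∈ L := (le_sup_left : F⟮ζ⟯ ≤ L) (mem_adjoin_simple_self F ζ)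
  have hxL : x ∈ L := (le_sup_right : F⟮x⟯ ≤ L) (mem_adjoin_simple_self F x)
  have hliftζ : lift F⟮(⟨ζ, hζL⟩ : L)⟯ = F⟮ζ⟯ := lift_adjoin_simple F L _
  have hliftx : lift F⟮(⟨x, hxL⟩ : L)⟯ = F⟮x⟯ := lift_adjoin_simple F L _
  have hmem : ∀ u : L, u ∈ F⟮(⟨ζ, hζL⟩ : L)⟯ ↔ (u : Ω) ∈ F⟮ζ⟯ := fun u => by
    rw [← hliftζ, mem_lift]
  have hfinL : FiniteDimensional F L :=
    .of_finrank_pos (hrank ▸ Nat.mul_pos Module.finrank_pos hp.pos)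
  have hcomm : IsMulCommutative (L ≃ₐ[F] L) := by
    refine AlgEquiv.isMulCommutative_of_kummer hp (ζ := (⟨ζ, hζL⟩ : L)) (x := ⟨x, hxL⟩)
      (.of_map_of_injective (f := L.val) hζ L.val.injective) (by simpa [Subtype.ext_iff] using hx0)
      ?_ ((hmem _).mpr hxp) fun σ => ?_
    · rw [← lift_inj, lift_sup, lift_top, hliftζ, hliftx]
    · obtain ⟨m, u, hu, h1, h2⟩ := hact (σ.liftNormal Ω)
      refine ⟨m, ⟨u, (le_sup_left : F⟮ζ⟯ ≤ L) hu⟩, (hmem _).mpr hu, Subtype.ext ?_, Subtype.ext ?_⟩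
      · exact (σ.liftNormal_commutes Ω ⟨ζ, hζL⟩).symm.trans h1
      · exact (σ.liftNormal_commutes Ω ⟨x, hxL⟩).symm.trans h2
  have habel : IsAbelianGalois F L := { }
  have hrankζ : Module.finrank F F⟮(⟨ζ, hζL⟩ : L)⟯ = Module.finrank F F⟮ζ⟯ := by
    rw [← hliftζ]
    exact (liftAlgEquiv _).toLinearEquiv.finrank_eq
  have hrankL : Module.finrank F⟮(⟨ζ, hζL⟩ : L)⟯ L = p := by
    have h := Module.finrank_mul_finrank F F⟮(⟨ζ, hζL⟩ : L)⟯ L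
    rw [hrank, hrankζ] at h
    exact Nat.eq_of_mul_eq_mul_left Module.finrank_pos h
  obtain ⟨E, hE, hEuniq⟩ := existsUnique_finrank_eq_of_coprime F⟮(⟨ζ, hζL⟩ : L)⟯
    (by rwa [hrankζ, hrankL])
  simp only [hrankL] at hE hEuniq
  refine ⟨⟨hgal, mul_comm'⟩, lift E, ?_, fun E' ⟨_, _, hE', hsup⟩ => ?_⟩
  · have hrankE : Module.finrank F ↥(lift E) = p :=
      (liftAlgEquiv E).toLinearEquiv.finrank_eq.symm.trans hE
    have hgalE : IsGalois F ↥(lift E) := .of_algEquiv (liftAlgEquiv E)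
    refine ⟨hgalE, ?_, hrankE, ?_⟩
    · have : FiniteDimensional F ↥(lift E) := .of_finrank_pos (hrankE ▸ hp.pos)
      exact isCyclic_of_prime_card ((IsGalois.card_aut_eq_finrank F ↥(lift E)).trans hrankE)
    · refine (eq_of_le_of_finrank_le (sup_le (lift_le E) le_sup_left) ?_).symm
      have : FiniteDimensional F ↥(lift E ⊔ F⟮ζ⟯) :=
        .of_injective (inclusion (sup_le (lift_le E) le_sup_left : lift E ⊔ F⟮ζ⟯ ≤ L)).toLinearMap
          (inclusion (sup_le (lift_le E) le_sup_left : lift E ⊔ F⟮ζ⟯ ≤ L)).injective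
      rw [hrank]
      refine Nat.le_of_dvd Module.finrank_pos (hcop.mul_dvd_of_dvd_of_dvd
        (finrank_dvd_of_le_right le_sup_right) ?_)
      rw [← hrankE]
      exact finrank_dvd_of_le_right le_sup_left
  · have hle : E' ≤ L := hsup ▸ le_sup_left
    rw [← lift_restrict hle, hEuniq (restrict hle)
      ((restrictAlgEquiv hle).toLinearEquiv.finrank_eq.symm.trans hE')]
end

section
/- Let V ⊆ K^×/(K^×)^p be the ω-eigenspace for the action of Δ, i.e. the set of classes x̄ of elements x ∈ K^× such that σ(x)·x^{−ω(σ)} ∈ (K^×)^p for every σ ∈ Δ. Then the map E ↦ D defined by the relation E(ζ) = K(x) for x a p-th root of a generator of D is a bijection from the set of cyclic extensions E|F of degree p inside Ω onto the set of 𝔽_p-lines (one-dimensional 𝔽_p-subspaces) D ⊆ V. -/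
open IntermediateField

/-- The subgroup of `p`-th powers in `Kˣ`. -/
noncomputable def pthPowers (p : ℕ) (K : Type*) [Field K] : Subgroup Kˣ :=
  (powMonoidHom p : Kˣ →* Kˣ).range

/-- The group `Kˣ/(Kˣ)ᵖ`. -/
abbrev KmodP (p : ℕ) (K : Type*) [Field K] :=
  Kˣ ⧸ pthPowers p K

/-- The `ω`-eigenspace `V ⊆ Kˣ/(Kˣ)ᵖ` for the action of `Δ = Gal(K|F)`: the set of classes
`x̄` of elements `x ∈ Kˣ` such that `σ(x)·x^{−ω(σ)} ∈ (Kˣ)ᵖ` for every `σ ∈ Δ`. -/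
def omegaEigenspace (p : ℕ) (F K : Type*) [Field F] [Field K] [Algebra F K]
    (ω : (K ≃ₐ[F] K) → (ZMod p)ˣ) : Set (KmodP p K) :=
  {c | ∃ x : Kˣ, (QuotientGroup.mk x : KmodP p K) = c ∧
    ∀ σ : K ≃ₐ[F] K, ∃ y : K, y ≠ 0 ∧ σ (x : K) = (x : K) ^ (ω σ : ZMod p).val * y ^ p}

lemma Subgroup.exists_normal_isComplement'_of_le_center {G : Type*} [Group G]
    {N : Subgroup G} (hN : N ≤ Subgroup.center G) (hcop : (Nat.card N).Coprime N.index) :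
    ∃ H : Subgroup G, H.Normal ∧ N.IsComplement' H := by
  have : N.Normal := ⟨fun n hn g => by
    rw [Subgroup.mem_center_iff.1 (hN hn) g, mul_inv_cancel_right]
    exact hn⟩
  obtain ⟨H, hH⟩ := Subgroup.exists_right_complement'_of_coprime hcop
  refine ⟨H, ⟨fun h hh g => ?_⟩, hH⟩
  obtain ⟨⟨n, k⟩, rfl⟩ := hH.2 g
  have hc := Subgroup.mem_center_iff.1 (hN n.2) ((k : G) * h * (k : G)⁻¹)
  have : (n : G) * k * h * ((n : G) * k)⁻¹ = k * h * (k : G)⁻¹ := by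
    calc (n : G) * k * h * ((n : G) * k)⁻¹ = n * (k * h * (k : G)⁻¹) * (n : G)⁻¹ := by group
      _ = k * h * (k : G)⁻¹ := by rw [← hc, mul_inv_cancel_right]
  change (n : G) * k * h * ((n : G) * k)⁻¹ ∈ H
  rw [this]
  exact H.mul_mem (H.mul_mem k.2 hh) (H.inv_mem k.2)

namespace IntermediateField

variable {F Ω : Type*} [Field F] [Field Ω] [Algebra F Ω] {K L : IntermediateField F Ω}

lemma sup_adjoin_simple_eq_of_relfinrank_prime {p : ℕ} (hp : p.Prime) (hKL : K ≤ L)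
    (h : relfinrank K L = p) {y : Ω} (hyL : y ∈ L) (hyK : y ∉ K) : K ⊔ F⟮y⟯ = L := by
  have hK : K ≤ K ⊔ F⟮y⟯ := le_sup_left
  have hL : K ⊔ F⟮y⟯ ≤ L := sup_le hKL (adjoin_simple_le_iff.2 hyL)
  have hy : y ∈ K ⊔ F⟮y⟯ := (le_sup_right : F⟮y⟯ ≤ _) (mem_adjoin_simple_self F y)
  have hmul := relfinrank_mul_relfinrank hK hL
  rw [h] at hmul
  rcases (Nat.dvd_prime hp).1 (Dvd.intro _ hmul) with h1 | h1
  · exact absurd (relfinrank_eq_one_iff.1 h1 hy) hyK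
  · rw [h1] at hmul
    exact le_antisymm hL (relfinrank_eq_one_iff.1 ((Nat.mul_eq_left hp.ne_zero).1 hmul))

/-- The equalizer of two automorphisms is an intermediate field. -/
lemma exists_mem_iff_algEquiv_eq (σ τ : Ω ≃ₐ[F] Ω) :
    ∃ M : IntermediateField F Ω, ∀ z, z ∈ M ↔ σ z = τ z := by
  refine ⟨{ AlgHom.equalizer (σ : Ω →ₐ[F] Ω) (τ : Ω →ₐ[F] Ω) with
    inv_mem' := fun x hx => ?_ }, fun z => Iff.rfl⟩
  change σ x = τ x at hx
  change σ x⁻¹ = τ x⁻¹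
  rw [map_inv₀, map_inv₀, hx]

lemma algEquiv_eqOn_sup {A B : IntermediateField F Ω} {σ τ : Ω ≃ₐ[F] Ω}
    (hA : ∀ z ∈ A, σ z = τ z) (hB : ∀ z ∈ B, σ z = τ z) {z : Ω} (hz : z ∈ A ⊔ B) :
    σ z = τ z := by
  obtain ⟨M, hM⟩ := exists_mem_iff_algEquiv_eq σ τ
  have : A ⊔ B ≤ M := sup_le (fun w hw => (hM w).2 (hA w hw)) (fun w hw => (hM w).2 (hB w hw))
  exact (hM z).1 (this hz)

lemma algEquiv_eqOn_sup_adjoin {A : IntermediateField F Ω} {x : Ω} {σ τ : Ω ≃ₐ[F] Ω}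
    (hA : ∀ z ∈ A, σ z = τ z) (hx : σ x = τ x) {z : Ω} (hz : z ∈ A ⊔ F⟮x⟯) :
    σ z = τ z := by
  obtain ⟨M, hM⟩ := exists_mem_iff_algEquiv_eq σ τ
  have : A ⊔ F⟮x⟯ ≤ M :=
    sup_le (fun w hw => (hM w).2 (hA w hw)) (adjoin_simple_le_iff.2 ((hM x).2 hx))
  exact (hM z).1 (this hz)

section Kummer

variable {p : ℕ} {ζ : Ω}

lemma exists_eq_zeta_pow_mul (hp : p.Prime) (hζ : IsPrimitiveRoot ζ p) {u v : Ω} (hv : v ≠ 0)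
    (h : u ^ p = v ^ p) : ∃ i : ℕ, u = ζ ^ i * v := by
  have : NeZero p := ⟨hp.ne_zero⟩
  obtain ⟨i, -, hi⟩ := hζ.eq_pow_of_pow_eq_one (ξ := u / v)
    (by rw [div_pow, h, div_self (pow_ne_zero _ hv)])
  exact ⟨i, by rw [hi, div_mul_cancel₀ _ hv]⟩

lemma mem_of_pow_eq_pow (hp : p.Prime) (hζ : IsPrimitiveRoot ζ p) (hζL : ζ ∈ L) {u v : Ω}
    (hv : v ∈ L) (h : u ^ p = v ^ p) : u ∈ L := by
  rcases eq_or_ne v 0 with rfl | hv0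
  · rw [zero_pow hp.ne_zero] at h
    rw [eq_zero_of_pow_eq_zero h]
    exact zero_mem _
  · obtain ⟨i, rfl⟩ := exists_eq_zeta_pow_mul hp hζ hv0 h
    exact mul_mem (pow_mem hζL _) hv

lemma irreducible_X_pow_sub_C_of_notMem (hp : p.Prime) (hζ : IsPrimitiveRoot ζ p) (hζK : ζ ∈ K)
    {x : Ω} (hx : x ∉ K) {a : K} (hxa : x ^ p = a) :
    Irreducible (Polynomial.X ^ p - Polynomial.C a) :=
  X_pow_sub_C_irreducible_of_prime hp fun b hb =>
    hx (mem_of_pow_eq_pow hp hζ hζK b.2 (by rw [hxa, ← hb]; rfl))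

lemma minpoly_eq_X_pow_sub_C_of_notMem (hp : p.Prime) (hζ : IsPrimitiveRoot ζ p) (hζK : ζ ∈ K)
    {x : Ω} (hx : x ∉ K) {a : K} (hxa : x ^ p = a) :
    minpoly K x = Polynomial.X ^ p - Polynomial.C a :=
  (minpoly.eq_of_irreducible_of_monic (irreducible_X_pow_sub_C_of_notMem hp hζ hζK hx hxa)
    (by simp [hxa]) (Polynomial.monic_X_pow_sub_C a hp.ne_zero)).symm

lemma relfinrank_sup_adjoin_simple_of_notMem (hp : p.Prime) (hζ : IsPrimitiveRoot ζ p)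
    (hζK : ζ ∈ K) {x : Ω} (hx : x ∉ K) {a : K} (hxa : x ^ p = a) :
    relfinrank K (K ⊔ F⟮x⟯) = p := by
  have hint : IsIntegral K x := by
    refine ⟨Polynomial.X ^ p - Polynomial.C a, Polynomial.monic_X_pow_sub_C a hp.ne_zero, ?_⟩
    simp [hxa]
  have h := adjoin.finrank hint
  rw [minpoly_eq_X_pow_sub_C_of_notMem hp hζ hζK hx hxa, Polynomial.natDegree_X_pow_sub_C] at h
  have heq : extendScalars (le_sup_left : K ≤ K ⊔ F⟮x⟯) = adjoin K {x} := by
    apply restrictScalars_injective F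
    rw [extendScalars_restrictScalars, restrictScalars_adjoin_eq_sup]
  rw [relfinrank_eq_finrank_of_le le_sup_left, heq, h]

lemma exists_algEquiv_apply_eq_zeta_mul [Normal F Ω] (hp : p.Prime) (hζ : IsPrimitiveRoot ζ p)
    (hζK : ζ ∈ K) {x : Ω} (hx : x ∉ K) {a : K} (hxa : x ^ p = a) :
    ∃ τ : Ω ≃ₐ[F] Ω, (∀ z ∈ K, τ z = z) ∧ τ x = ζ * x := by
  have : Normal K Ω := Normal.tower_top_of_normal F K Ω
  have hζx : ζ * x ∉ K := fun h => hx <| by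
    have := mul_mem (inv_mem hζK) h
    rwa [inv_mul_cancel_left₀ (hζ.ne_zero hp.ne_zero)] at this
  have hpow : (ζ * x) ^ p = a := by rw [mul_pow, hζ.pow_eq_one, one_mul, hxa]
  have hconj : IsConjRoot K (ζ * x) x := by
    rw [isConjRoot_def, minpoly_eq_X_pow_sub_C_of_notMem hp hζ hζK hx hxa,
      minpoly_eq_X_pow_sub_C_of_notMem hp hζ hζK hζx hpow]
  obtain ⟨τ, hτ⟩ := isConjRoot_iff_exists_algEquiv.1 hconj
  exact ⟨τ.restrictScalars F, fun z hz => τ.commutes ⟨z, hz⟩, hτ⟩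

lemma mem_of_algEquiv_apply_eq_self (hp : p.Prime) (hζ : IsPrimitiveRoot ζ p)
    (hKL : K ≤ L) (hL : relfinrank K L = p) {x : Ω} (hxL : x ∈ L) (hx0 : x ≠ 0)
    {τ : Ω ≃ₐ[F] Ω} (hτ : ∀ z ∈ K, τ z = z) (hτx : τ x = ζ * x) {y : Ω} (hyL : y ∈ L)
    (hy : τ y = y) : y ∈ K := by
  by_contra hyK
  rw [← sup_adjoin_simple_eq_of_relfinrank_prime hp hKL hL hyL hyK] at hxL
  have h : τ x = (AlgEquiv.refl : Ω ≃ₐ[F] Ω) x := algEquiv_eqOn_sup_adjoin hτ hy hxL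
  rw [hτx, AlgEquiv.coe_refl, id, mul_eq_right₀ hx0] at h
  exact hζ.ne_one hp.one_lt h

/-- Kummer theory in prime degree: the `p`-th roots in `L` of elements of `K` are, up to factors
in `K`, powers of a single one. -/
lemma exists_eq_pow_mul_of_pow_mem [Normal F Ω] (hp : p.Prime) (hζ : IsPrimitiveRoot ζ p)
    (hζK : ζ ∈ K) (hKL : K ≤ L) (hL : relfinrank K L = p) {x : Ω} (hxL : x ∈ L) (hx : x ∉ K)
    {a : K} (hxa : x ^ p = a) {z : Ω} (hzL : z ∈ L) (hz0 : z ≠ 0) (hz : z ^ p ∈ K) :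
    ∃ (j : ℕ) (y : K), z = x ^ j * y := by
  have hx0 : x ≠ 0 := fun h => hx (h ▸ zero_mem K)
  obtain ⟨τ, hτ, hτx⟩ := exists_algEquiv_apply_eq_zeta_mul hp hζ hζK hx hxa
  obtain ⟨j, hj⟩ := exists_eq_zeta_pow_mul hp hζ hz0 (u := τ z) (by rw [← map_pow, hτ _ hz])
  have hmem : z * (x ^ j)⁻¹ ∈ K := by
    refine mem_of_algEquiv_apply_eq_self hp hζ hKL hL hxL hx0 hτ hτx
      (mul_mem hzL (inv_mem (pow_mem hxL j))) ?_
    have := hζ.ne_zero hp.ne_zero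
    rw [map_mul, map_inv₀, map_pow, hτx, hj, mul_pow]
    field_simp
  exact ⟨j, ⟨_, hmem⟩, by field_simp⟩

lemma exists_notMem_pow_mem_of_coprime (hp : p.Prime) (hζ : IsPrimitiveRoot ζ p) (hζK : ζ ∈ K)
    [FiniteDimensional F K] [IsGalois F K] {E : IntermediateField F Ω} [IsGalois F E]
    (hE : Module.finrank F E = p) (hcop : (Module.finrank F K).Coprime p) :
    relfinrank K (E ⊔ K) = p ∧ ∃ x ∈ E ⊔ K, x ∉ K ∧ x ^ p ∈ K := by
  have : Fact p.Prime := ⟨hp⟩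
  have : FiniteDimensional F E := FiniteDimensional.of_finrank_pos (hE ▸ hp.pos)
  have hKL : K ≤ E ⊔ K := le_sup_right
  have hsup : Module.finrank F ↥(E ⊔ K) = p * Module.finrank F K := by
    rw [← hE]
    exact (LinearDisjoint.of_finrank_coprime (by rw [hE]; exact hcop.symm)).finrank_sup
  have hrel : relfinrank K (E ⊔ K) = p := by
    have h := finrank_bot_mul_relfinrank hKL
    rw [hsup, mul_comm p] at h
    exact Nat.eq_of_mul_eq_mul_left Module.finrank_pos h
  refine ⟨hrel, ?_⟩
  have hfin : Module.finrank K (extendScalars hKL) = p := by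
    rw [← relfinrank_eq_finrank_of_le, hrel]
  have : FiniteDimensional K (extendScalars hKL) :=
    FiniteDimensional.of_finrank_pos (hfin ▸ hp.pos)
  have : IsGalois F (extendScalars hKL) := inferInstanceAs (IsGalois F ↥(E ⊔ K))
  have : IsGalois K (extendScalars hKL) := IsGalois.tower_top_of_isGalois F K _
  have : IsCyclic (extendScalars hKL ≃ₐ[K] extendScalars hKL) :=
    isCyclic_of_prime_card (p := p) (by rw [IsGalois.card_aut_eq_finrank, hfin])
  have hprim : (primitiveRoots (Module.finrank K (extendScalars hKL)) K).Nonempty := by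
    refine ⟨⟨ζ, hζK⟩, ?_⟩
    rw [hfin, mem_primitiveRoots hp.pos]
    exact IsPrimitiveRoot.of_map_of_injective (f := algebraMap K Ω) hζ (algebraMap K Ω).injective
  obtain ⟨α, ⟨b, hb⟩, htop⟩ := exists_root_adjoin_eq_top_of_isCyclic K (extendScalars hKL) hprim
  rw [hfin] at hb
  refine ⟨α, α.2, fun hα => ?_, ?_⟩
  · have hbot : adjoin K {α} = ⊥ := adjoin_simple_eq_bot_iff.2 ⟨⟨(α : Ω), hα⟩, rfl⟩
    rw [htop] at hbot
    have h1 : Module.finrank K (extendScalars hKL) = 1 := by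
      rw [← finrank_top', hbot, IntermediateField.finrank_bot]
    exact hp.ne_one (hfin.symm.trans h1)
  · have hbΩ : (b : Ω) = (α : Ω) ^ p := congrArg Subtype.val hb
    rw [← hbΩ]
    exact b.2

lemma exists_algEquiv_extends [Normal F Ω] [Normal F K] (σ : K ≃ₐ[F] K) :
    ∃ σ' : Ω ≃ₐ[F] Ω, ∀ z : K, σ' z = σ z :=
  ⟨σ.liftNormal Ω, fun z => σ.liftNormal_commutes Ω z⟩

lemma algEquiv_apply_mem [Normal F Ω] (L : IntermediateField F Ω) [Normal F L] (σ : Ω ≃ₐ[F] Ω)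
    {z : Ω} (hz : z ∈ L) : σ z ∈ L :=
  normal_iff_forall_map_le'.1 ‹Normal F L› σ ⟨z, hz, rfl⟩

lemma algEquiv_comm_of_isCyclic {E : IntermediateField F Ω} [Normal F E]
    [IsCyclic (E ≃ₐ[F] E)] (σ τ : Ω ≃ₐ[F] Ω) {z : Ω} (hz : z ∈ E) : σ (τ z) = τ (σ z) := by
  have h : σ.restrictNormal E * τ.restrictNormal E = τ.restrictNormal E * σ.restrictNormal E :=
    IsCyclic.commGroup.mul_comm _ _
  have h' := congrArg (fun f => ((f ⟨z, hz⟩ : E) : Ω)) h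
  simp only [AlgEquiv.mul_apply] at h'
  have key : ∀ (ρ : Ω ≃ₐ[F] Ω) (w : E), ((ρ.restrictNormal E w : E) : Ω) = ρ w :=
    fun ρ w => ρ.restrictNormal_commutes E w
  simpa only [key] using h'

lemma exists_apply_eq_pow_mul_pow [Normal F Ω] (hp : p.Prime) (hζ : IsPrimitiveRoot ζ p)
    (hζK : ζ ∈ K) [Normal F K] {E : IntermediateField F Ω} [Normal F E] [IsCyclic (E ≃ₐ[F] E)]
    (hrel : relfinrank K (E ⊔ K) = p) (σ : K ≃ₐ[F] K) {m : ℕ}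
    (hσ : (σ ⟨ζ, hζK⟩ : Ω) = ζ ^ m) {a : K} (ha : a ≠ 0) {z : Ω} (hz : z ∈ E ⊔ K)
    (hza : z ^ p = a) : ∃ y : K, y ≠ 0 ∧ σ a = a ^ m * y ^ p := by
  have hz0 : z ≠ 0 := by
    rintro rfl
    rw [zero_pow hp.ne_zero] at hza
    exact ha (Subtype.ext hza.symm)
  obtain ⟨σ', hσ'⟩ := exists_algEquiv_extends σ
  have hw0 : σ' z * (z ^ m)⁻¹ ≠ 0 :=
    mul_ne_zero ((map_ne_zero σ').2 hz0) (inv_ne_zero (pow_ne_zero _ hz0))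
  suffices hw : σ' z * (z ^ m)⁻¹ ∈ K by
    refine ⟨⟨_, hw⟩, fun h => hw0 (congrArg Subtype.val h), Subtype.ext ?_⟩
    have h1 : (σ a : Ω) = σ' z ^ p := by rw [← hσ', ← hza, map_pow]
    have h2 : ((a : Ω)) ^ m * (σ' z * (z ^ m)⁻¹) ^ p = σ' z ^ p := by
      rw [← hza, mul_pow, inv_pow, pow_right_comm]
      field_simp
    exact h1.trans h2.symm
  by_cases hzK : z ∈ K
  · exact mul_mem (algEquiv_apply_mem K σ' hzK) (inv_mem (pow_mem hzK _))
  obtain ⟨τ, hτ, hτz⟩ := exists_algEquiv_apply_eq_zeta_mul hp hζ hζK hzK hza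
  refine mem_of_algEquiv_apply_eq_self hp hζ le_sup_right hrel hz hz0 hτ hτz
    (mul_mem (algEquiv_apply_mem (E ⊔ K) σ' hz) (inv_mem (pow_mem hz _))) ?_
  have hcomm : τ (σ' z) = σ' (τ z) :=
    algEquiv_eqOn_sup (σ := σ'.trans τ) (τ := τ.trans σ')
      (fun w hw => algEquiv_comm_of_isCyclic τ σ' hw)
      (fun w hw => by
        rw [AlgEquiv.trans_apply, AlgEquiv.trans_apply, hτ w hw,
          hτ _ (algEquiv_apply_mem K σ' hw)]) hz
  have hζ0 := hζ.ne_zero hp.ne_zero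
  have hσζ : σ' ζ = ζ ^ m := (hσ' ⟨ζ, hζK⟩).trans hσ
  rw [map_mul, map_inv₀, map_pow, hcomm, hτz, map_mul, hσζ, mul_pow]
  field_simp

/-- If `Gal(L|K)` is central in `Gal(L|F)` and `[L : K]` is prime to `[K : F]`, then `K` has a
complement in `L` that is Galois over `F`. -/
lemma exists_isGalois_sup_eq_of_central [IsGalois F L] [FiniteDimensional F L] (hKL : K ≤ L)
    (hcentral : ∀ σ τ : L ≃ₐ[F] L, (∀ z : L, (z : Ω) ∈ K → τ z = z) → σ * τ = τ * σ)
    (hcop : (Module.finrank F K).Coprime (relfinrank K L)) :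
    ∃ E : IntermediateField F Ω,
      IsGalois F E ∧ Module.finrank F E = relfinrank K L ∧ E ⊔ K = L := by
  set N := (restrict hKL).fixingSubgroup with hNdef
  have hindex : N.index = Module.finrank F K := by
    rw [hNdef, ← finrank_eq_fixingSubgroup_index]
    exact (restrictAlgEquiv hKL).toLinearEquiv.finrank_eq.symm
  have : FiniteDimensional F K :=
    FiniteDimensional.of_injective (inclusion hKL).toLinearMap (inclusion hKL).injective
  have hcard : Nat.card N = relfinrank K L := by
    have h := N.card_mul_index
    rw [IsGalois.card_aut_eq_finrank, hindex, ← finrank_bot_mul_relfinrank hKL, mul_comm] at h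
    exact Nat.eq_of_mul_eq_mul_left Module.finrank_pos h
  have hcenter : N ≤ Subgroup.center (L ≃ₐ[F] L) := fun τ hτ =>
    Subgroup.mem_center_iff.2 fun σ => hcentral σ τ fun z hz =>
      (mem_fixingSubgroup_iff _ τ).1 hτ z ((mem_restrict hKL z).2 hz)
  obtain ⟨H, hHn, hH⟩ := Subgroup.exists_normal_isComplement'_of_le_center hcenter
    (by rw [hcard, hindex]; exact hcop.symm)
  have hgal : IsGalois F (fixedField H) := IsGalois.of_fixedField_normal_subgroup H
  refine ⟨lift (fixedField H), IsGalois.of_algEquiv (liftAlgEquiv _), ?_, ?_⟩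
  · rw [← (liftAlgEquiv (fixedField H)).toLinearEquiv.finrank_eq,
      finrank_eq_fixingSubgroup_index, fixingSubgroup_fixedField, hH.index_eq_card, hcard]
  · have htop : fixedField H ⊔ restrict hKL = ⊤ := by
      rw [← IsGalois.fixedField_fixingSubgroup (fixedField H ⊔ restrict hKL), fixingSubgroup_sup,
        fixingSubgroup_fixedField, hH.symm.disjoint.eq_bot, fixedField_bot]
    have hlift := lift_sup (F := F) L (fixedField H) (restrict hKL)
    rwa [htop, lift_top, lift_restrict, eq_comm] at hlift

lemma isSeparable_sup_adjoin_simple_of_pow_mem (hpF : (p : F) ≠ 0)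
    {x : Ω} {a : K} [Algebra.IsSeparable F K] (hx0 : x ≠ 0) (hxa : x ^ p = a) :
    Algebra.IsSeparable F ↥(K ⊔ F⟮x⟯) := by
  have hpK : (p : K) ≠ 0 := by
    rw [← map_natCast (algebraMap F K)]
    exact (map_ne_zero _).2 hpF
  have ha0 : a ≠ 0 := by
    rintro rfl
    exact hx0 (eq_zero_of_pow_eq_zero hxa)
  have hsep : IsSeparable K x :=
    (Polynomial.separable_X_pow_sub_C a hpK ha0).of_dvd (minpoly.dvd K x (by simp [hxa]))
  have h1 : Algebra.IsSeparable K (adjoin K {x}) :=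
    (isSeparable_adjoin_simple_iff_isSeparable K Ω).2 hsep
  have h2 : Algebra.IsSeparable F (adjoin K {x}) := Algebra.IsSeparable.trans F K _
  rw [← restrictScalars_adjoin_eq_sup]
  exact h2

section Descent

variable [Normal F K] {x : Ω} {a : K}

lemma exists_apply_eq_pow_mul (hp : p.Prime) (hζ : IsPrimitiveRoot ζ p) (hζK : ζ ∈ K)
    (hx0 : x ≠ 0) (hxa : x ^ p = a)
    (ha : ∀ σ : K ≃ₐ[F] K, ∃ m : ℕ, (σ ⟨ζ, hζK⟩ : Ω) = ζ ^ m ∧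
      ∃ y : K, y ≠ 0 ∧ σ a = a ^ m * y ^ p) (σ : Ω ≃ₐ[F] Ω) :
    ∃ m : ℕ, σ ζ = ζ ^ m ∧ ∃ y ∈ K, σ x = x ^ m * y := by
  have key : ∀ w : K, ((σ.restrictNormal K w : K) : Ω) = σ w :=
    fun w => σ.restrictNormal_commutes K w
  obtain ⟨m, hm, y, hy0, hy⟩ := ha (σ.restrictNormal K)
  rw [key] at hm
  have hy0' : (y : Ω) ≠ 0 := fun h => hy0 (Subtype.ext h)
  have hpow : σ x ^ p = (x ^ m * (y : Ω)) ^ p := by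
    rw [← map_pow, hxa, ← key, hy, mul_pow, pow_right_comm, hxa]
    rfl
  obtain ⟨i, hi⟩ := exists_eq_zeta_pow_mul hp hζ (mul_ne_zero (pow_ne_zero _ hx0) hy0') hpow
  exact ⟨m, hm, ζ ^ i * y, mul_mem (pow_mem hζK _) y.2, by rw [hi]; ring⟩

lemma normal_sup_adjoin_simple [Normal F Ω]
    (hx : ∀ σ : Ω ≃ₐ[F] Ω, ∃ m : ℕ, ∃ y ∈ K, σ x = x ^ m * y) :
    Normal F ↥(K ⊔ F⟮x⟯) := by
  refine normal_iff_forall_map_le'.2 fun σ => ?_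
  rw [IntermediateField.map_sup, adjoin_map, Set.image_singleton]
  refine sup_le ((normal_iff_forall_map_le'.1 ‹Normal F K› σ).trans le_sup_left)
    (adjoin_simple_le_iff.2 ?_)
  obtain ⟨m, y, hy, h⟩ := hx σ
  change σ x ∈ _
  rw [h]
  exact mul_mem (pow_mem ((le_sup_right : F⟮x⟯ ≤ _) (mem_adjoin_simple_self F x)) _)
    ((le_sup_left : K ≤ _) hy)

/-- Kummer descent: if `K(x)|K` is generated by a `p`-th root of an element of `K` whose class
lies in the cyclotomic eigenspace, then `K(x)` is the compositum of `K` and a Galois extension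
of `F` of degree `p`. -/
lemma exists_isGalois_sup_eq_of_eigen [Normal F Ω] (hp : p.Prime) (hpF : (p : F) ≠ 0)
    (hζ : IsPrimitiveRoot ζ p) (hζK : ζ ∈ K) [FiniteDimensional F K] [IsGalois F K]
    (hcop : (Module.finrank F K).Coprime p) (hx : x ∉ K) (hxa : x ^ p = a)
    (ha : ∀ σ : K ≃ₐ[F] K, ∃ m : ℕ, (σ ⟨ζ, hζK⟩ : Ω) = ζ ^ m ∧
      ∃ y : K, y ≠ 0 ∧ σ a = a ^ m * y ^ p) :
    ∃ E : IntermediateField F Ω, IsGalois F E ∧ Module.finrank F E = p ∧ E ⊔ K = K ⊔ F⟮x⟯ := by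
  have hx0 : x ≠ 0 := fun h => hx (h ▸ zero_mem K)
  have hact := exists_apply_eq_pow_mul hp hζ hζK hx0 hxa ha
  have hnormal : Normal F ↥(K ⊔ F⟮x⟯) :=
    normal_sup_adjoin_simple fun σ => (hact σ).imp fun _ h => h.2
  have hsep := isSeparable_sup_adjoin_simple_of_pow_mem hpF hx0 hxa
  have hgal : IsGalois F ↥(K ⊔ F⟮x⟯) := { }
  have hrel := relfinrank_sup_adjoin_simple_of_notMem hp hζ hζK hx hxa
  have hfin : FiniteDimensional F ↥(K ⊔ F⟮x⟯) := FiniteDimensional.of_finrank_pos <| by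
    rw [← finrank_bot_mul_relfinrank (le_sup_left : K ≤ K ⊔ F⟮x⟯), hrel]
    exact Nat.mul_pos Module.finrank_pos hp.pos
  suffices hcentral : ∀ σ τ : ↥(K ⊔ F⟮x⟯) ≃ₐ[F] ↥(K ⊔ F⟮x⟯),
      (∀ z : ↥(K ⊔ F⟮x⟯), (z : Ω) ∈ K → τ z = z) → σ * τ = τ * σ by
    obtain ⟨E, hE, hEp, hEK⟩ :=
      exists_isGalois_sup_eq_of_central le_sup_left hcentral (by rwa [hrel])
    exact ⟨E, hE, hEp.trans hrel, hEK⟩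
  intro σ τ hτ
  obtain ⟨σ', hσ'⟩ := exists_algEquiv_extends σ
  obtain ⟨τ', hτ'⟩ := exists_algEquiv_extends τ
  have hτK : ∀ z ∈ K, τ' z = z := fun z hz => by
    have hzL : z ∈ K ⊔ F⟮x⟯ := (le_sup_left : K ≤ _) hz
    rw [hτ' ⟨z, hzL⟩, hτ ⟨z, hzL⟩ hz]
  have hτx : ∃ i : ℕ, τ' x = ζ ^ i * x := by
    refine exists_eq_zeta_pow_mul hp hζ hx0 ?_
    rw [← map_pow, hxa, hτK _ a.2]
  obtain ⟨i, hi⟩ := hτx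
  obtain ⟨m, hm, y, hyK, hy⟩ := hact σ'
  have hcomm : σ' (τ' x) = τ' (σ' x) := by
    rw [hi, hy, map_mul, map_mul, map_pow, map_pow, hm, hi, hy, hτK y hyK]
    ring
  refine AlgEquiv.ext fun z => Subtype.ext ?_
  have hz : σ' (τ' z) = τ' (σ' z) :=
    algEquiv_eqOn_sup_adjoin (σ := τ'.trans σ') (τ := σ'.trans τ')
      (fun w hw => by
        rw [AlgEquiv.trans_apply, AlgEquiv.trans_apply, hτK w hw,
          hτK _ (algEquiv_apply_mem K σ' hw)]) hcomm z.2
  rw [hτ', hσ', hσ', hτ'] at hz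
  exact hz

end Descent

lemma eq_of_sup_eq_sup_of_coprime (hp : p.Prime) [FiniteDimensional F K]
    {E E' : IntermediateField F Ω} [IsGalois F E] (hE : Module.finrank F E = p)
    (hE' : Module.finrank F E' = p) (hcop : (Module.finrank F K).Coprime p)
    (hrel : relfinrank K (E ⊔ K) = p) (h : E ⊔ K = E' ⊔ K) : E = E' := by
  have : FiniteDimensional F E := FiniteDimensional.of_finrank_pos (hE ▸ hp.pos)
  have : FiniteDimensional F E' := FiniteDimensional.of_finrank_pos (hE' ▸ hp.pos)
  have hmul := finrank_bot_mul_relfinrank (inf_le_left : E ⊓ E' ≤ E)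
  rw [hE] at hmul
  rcases (Nat.dvd_prime hp).1 (Dvd.intro _ hmul) with h1 | h1
  · have hsup := (LinearDisjoint.of_inf_eq_bot (finrank_eq_one_iff.1 h1)).finrank_sup
    have hle : E ⊔ E' ≤ E ⊔ K := sup_le le_sup_left (h ▸ le_sup_left)
    have hdvd : Module.finrank F ↥(E ⊔ E') ∣ Module.finrank F ↥(E ⊔ K) :=
      Dvd.intro _ (finrank_bot_mul_relfinrank hle)
    rw [hsup, ← finrank_bot_mul_relfinrank (le_sup_right : K ≤ E ⊔ K), hrel, hE, hE'] at hdvd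
    have := Nat.dvd_of_mul_dvd_mul_right hp.pos hdvd
    exact absurd (hcop.symm.eq_one_of_dvd this) hp.ne_one
  · rw [h1] at hmul
    have hle : E ≤ E ⊓ E' := relfinrank_eq_one_iff.1 ((Nat.mul_eq_left hp.ne_zero).1 hmul)
    exact eq_of_le_of_finrank_eq (hle.trans inf_le_right) (hE.trans hE'.symm)

section Cyclotomic

lemma isGalois_adjoin_simple_of_isPrimitiveRoot [Normal F Ω] (hp : p.Prime)
    (hpF : (p : F) ≠ 0) (hζ : IsPrimitiveRoot ζ p) : IsGalois F F⟮ζ⟯ := by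
  have : NeZero p := ⟨hp.ne_zero⟩
  have hsep : IsSeparable F ζ :=
    (Polynomial.separable_X_pow_sub_C (1 : F) hpF one_ne_zero).of_dvd
      (minpoly.dvd F ζ (by simp [hζ.pow_eq_one]))
  have h1 : Algebra.IsSeparable F F⟮ζ⟯ := (isSeparable_adjoin_simple_iff_isSeparable F Ω).2 hsep
  have h2 : Normal F F⟮ζ⟯ := by
    refine normal_iff_forall_map_le'.2 fun σ => ?_
    rw [adjoin_map, Set.image_singleton, adjoin_simple_le_iff]
    obtain ⟨i, -, hi⟩ := hζ.eq_pow_of_pow_eq_one (ξ := σ ζ)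
      (by rw [← map_pow, hζ.pow_eq_one, map_one])
    change σ ζ ∈ _
    rw [← hi]
    exact pow_mem (mem_adjoin_simple_self F ζ) i
  exact { }

lemma isIntegral_of_isPrimitiveRoot (hp : p.Prime) (hζ : IsPrimitiveRoot ζ p) : IsIntegral F ζ :=
  ⟨Polynomial.X ^ p - Polynomial.C 1, Polynomial.monic_X_pow_sub_C 1 hp.ne_zero,
    by simp [hζ.pow_eq_one]⟩

lemma finrank_adjoin_simple_coprime_of_isPrimitiveRoot (hp : p.Prime)
    (hζ : IsPrimitiveRoot ζ p) : (Module.finrank F F⟮ζ⟯).Coprime p := by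
  have hint : IsIntegral F ζ := isIntegral_of_isPrimitiveRoot hp hζ
  have : FiniteDimensional F F⟮ζ⟯ := adjoin.finiteDimensional hint
  have hdvd : minpoly F ζ ∣ Polynomial.cyclotomic p F := by
    refine minpoly.dvd F ζ ?_
    rw [Polynomial.aeval_def, ← Polynomial.eval_map, Polynomial.map_cyclotomic]
    exact hζ.isRoot_cyclotomic hp.pos
  have hle := Polynomial.natDegree_le_of_dvd hdvd (Polynomial.cyclotomic_ne_zero p F)
  rw [Polynomial.natDegree_cyclotomic, Nat.totient_prime hp, ← adjoin.finrank hint] at hle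
  exact (Nat.coprime_of_lt_prime Module.finrank_pos.ne' (by have := hp.pos; omega) hp).symm

end Cyclotomic
section KummerSubgroup

lemma mk_eq_one_iff {a : Kˣ} :
    (QuotientGroup.mk a : KmodP p K) = 1 ↔ ∃ b : Kˣ, b ^ p = a :=
  QuotientGroup.eq_one_iff a

variable (K L p) in
/-- The subgroup of `Kˣ/(Kˣ)ᵖ` formed by the classes of the elements having a `p`-th root
in `L`. -/
noncomputable def kummerSubgroup : Subgroup (KmodP p K) :=
  Subgroup.map (QuotientGroup.mk' (pthPowers p K))
    { carrier := {a : Kˣ | ∃ z ∈ L, z ^ p = ((a : K) : Ω)}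
      one_mem' := ⟨1, one_mem L, by simp⟩
      mul_mem' := by
        rintro a b ⟨z, hz, hza⟩ ⟨w, hw, hwb⟩
        exact ⟨z * w, mul_mem hz hw, by rw [mul_pow, hza, hwb]; rfl⟩
      inv_mem' := by
        rintro a ⟨z, hz, hza⟩
        refine ⟨z⁻¹, inv_mem hz, ?_⟩
        rw [inv_pow, hza, Units.val_inv_eq_inv_val]
        rfl }

lemma mem_kummerSubgroup_iff {c : KmodP p K} :
    c ∈ kummerSubgroup K L p ↔
      ∃ a : Kˣ, (∃ z ∈ L, z ^ p = ((a : K) : Ω)) ∧ QuotientGroup.mk a = c :=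
  Iff.rfl

lemma mk_mem_kummerSubgroup_iff (hKL : K ≤ L) {a : Kˣ} :
    QuotientGroup.mk a ∈ kummerSubgroup K L p ↔ ∃ z ∈ L, z ^ p = ((a : K) : Ω) := by
  refine ⟨fun h => ?_, fun h => mem_kummerSubgroup_iff.2 ⟨a, h, rfl⟩⟩
  obtain ⟨b, ⟨z, hz, hzb⟩, hba⟩ := mem_kummerSubgroup_iff.1 h
  obtain ⟨c, hc⟩ := QuotientGroup.eq.1 hba
  refine ⟨z * ((c : K) : Ω), mul_mem hz (hKL (c : K).2), ?_⟩
  have hbc : b * c ^ p = a := by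
    rw [show c ^ p = b⁻¹ * a from hc, mul_inv_cancel_left]
  rw [mul_pow, hzb, ← hbc]
  rfl

lemma mk_ne_one_iff_notMem (hp : p.Prime) (hζ : IsPrimitiveRoot ζ p) (hζK : ζ ∈ K)
    {a : Kˣ} {x : Ω} (hxa : x ^ p = ((a : K) : Ω)) :
    (QuotientGroup.mk a : KmodP p K) ≠ 1 ↔ x ∉ K := by
  rw [Ne, mk_eq_one_iff, not_iff_not]
  constructor
  · rintro ⟨b, rfl⟩
    exact mem_of_pow_eq_pow hp hζ hζK (b : K).2 hxa
  · intro hx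
    have hx0 : (⟨x, hx⟩ : K) ≠ 0 := fun h => by
      have h0 : x = 0 := congrArg Subtype.val h
      rw [h0, zero_pow hp.ne_zero] at hxa
      exact a.ne_zero (Subtype.ext hxa.symm)
    exact ⟨Units.mk0 ⟨x, hx⟩ hx0, Units.ext (Subtype.ext hxa)⟩

lemma orderOf_eq_of_ne_one (hp : p.Prime) {c : KmodP p K} (hc : c ≠ 1) : orderOf c = p := by
  have : Fact p.Prime := ⟨hp⟩
  refine orderOf_eq_prime ?_ hc
  obtain ⟨a, rfl⟩ := QuotientGroup.mk_surjective c
  exact mk_eq_one_iff.2 ⟨a, rfl⟩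

lemma eq_zpowers_of_card_eq (hp : p.Prime) {D : Subgroup (KmodP p K)} (hD : Nat.card D = p)
    {c : KmodP p K} (hcD : c ∈ D) (hc : c ≠ 1) : D = Subgroup.zpowers c := by
  have : Finite D := Nat.finite_of_card_ne_zero (by rw [hD]; exact hp.ne_zero)
  refine (Subgroup.eq_of_le_of_card_ge (Subgroup.zpowers_le.2 hcD) ?_).symm
  rw [hD, Nat.card_zpowers, orderOf_eq_of_ne_one hp hc]

lemma card_kummerSubgroup [Normal F Ω] (hp : p.Prime) (hζ : IsPrimitiveRoot ζ p) (hζK : ζ ∈ K)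
    (hKL : K ≤ L) (hL : relfinrank K L = p) {x : Ω} (hxL : x ∈ L) (hx : x ∉ K) {a : Kˣ}
    (hxa : x ^ p = ((a : K) : Ω)) : Nat.card (kummerSubgroup K L p) = p := by
  have hc := (mk_ne_one_iff_notMem hp hζ hζK hxa).2 hx
  suffices h : kummerSubgroup K L p = Subgroup.zpowers (QuotientGroup.mk a) by
    rw [h, Nat.card_zpowers, orderOf_eq_of_ne_one hp hc]
  refine le_antisymm (fun d hd => ?_)
    (Subgroup.zpowers_le.2 ((mk_mem_kummerSubgroup_iff hKL).2 ⟨x, hxL, hxa⟩))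
  obtain ⟨b, ⟨z, hzL, hzb⟩, rfl⟩ := mem_kummerSubgroup_iff.1 hd
  have hz0 : z ≠ 0 := by
    rintro rfl
    rw [zero_pow hp.ne_zero] at hzb
    exact b.ne_zero (Subtype.ext hzb.symm)
  obtain ⟨j, y, hy⟩ := exists_eq_pow_mul_of_pow_mem hp hζ hζK hKL hL hxL hx hxa hzL hz0
    (hzb ▸ (b : K).2)
  have hy0 : y ≠ 0 := by
    rintro rfl
    exact hz0 (by rw [hy, ZeroMemClass.coe_zero, mul_zero])
  have hb : b = a ^ j * Units.mk0 y hy0 ^ p := by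
    refine Units.ext (Subtype.ext ?_)
    rw [← hzb, hy, mul_pow, pow_right_comm, hxa]
    rfl
  refine Subgroup.mem_zpowers_iff.2 ⟨j, ?_⟩
  rw [zpow_natCast, hb, QuotientGroup.mk_mul, mk_eq_one_iff.2 ⟨_, rfl⟩]
  exact (mul_one (QuotientGroup.mk (a ^ j) : KmodP p K)).symm

end KummerSubgroup
end Kummer

end IntermediateField

/-- Let `p` be a prime, `F` a field in which `p` is invertible, `Ω` an algebraic closure of
`F`, `ζ ∈ Ω` a primitive `p`-th root of unity, `K = F(ζ)`, `Δ = Gal(K|F)` and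
`ω : Δ → (ℤ/pℤ)ˣ` the mod-`p` cyclotomic character.  Let `V ⊆ Kˣ/(Kˣ)ᵖ` be the
`ω`-eigenspace for the action of `Δ`.  Then the map `E ↦ D` defined by the relation
`E(ζ) = K(x)` for `x` a `p`-th root of a generator of `D` is a bijection from the set of
cyclic extensions `E|F` of degree `p` inside `Ω` onto the set of `𝔽_p`-lines
(i.e. subgroups of order `p`) `D ⊆ V`. -/
theorem statement2 (p : ℕ) (hp : p.Prime)
    (F : Type*) [Field F] (hpF : (p : F) ≠ 0)
    (Ω : Type*) [Field Ω] [Algebra F Ω] [IsAlgClosure F Ω]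
    (ζ : Ω) (hζ : IsPrimitiveRoot ζ p)
    (ω : (↥(adjoin F {ζ}) ≃ₐ[F] ↥(adjoin F {ζ})) → (ZMod p)ˣ)
    (hω : ∀ σ : ↥(adjoin F {ζ}) ≃ₐ[F] ↥(adjoin F {ζ}),
      ((σ ⟨ζ, mem_adjoin_simple_self F ζ⟩ : ↥(adjoin F {ζ})) : Ω) = ζ ^ (ω σ : ZMod p).val) :
    ∃ Φ : {E : IntermediateField F Ω //
            IsGalois F ↥E ∧ IsCyclic (↥E ≃ₐ[F] ↥E) ∧ Module.finrank F ↥E = p} ≃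
          {D : Subgroup (KmodP p ↥(adjoin F {ζ})) //
            Nat.card D = p ∧ (D : Set (KmodP p ↥(adjoin F {ζ}))) ⊆
              omegaEigenspace p F ↥(adjoin F {ζ}) ω},
      ∀ (E : {E : IntermediateField F Ω //
            IsGalois F ↥E ∧ IsCyclic (↥E ≃ₐ[F] ↥E) ∧ Module.finrank F ↥E = p})
        (a : (↥(adjoin F {ζ}))ˣ),
        (QuotientGroup.mk a : KmodP p ↥(adjoin F {ζ})) ∈ (Φ E : Subgroup _) →
        (QuotientGroup.mk a : KmodP p ↥(adjoin F {ζ})) ≠ 1 →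
        ∀ x : Ω, x ^ p = ((a : ↥(adjoin F {ζ})) : Ω) →
          (E : IntermediateField F Ω) ⊔ adjoin F {ζ} = adjoin F {ζ} ⊔ adjoin F {x} := by
  have hnormal : Normal F Ω := IsAlgClosure.normal F Ω
  have hclosed : IsAlgClosed Ω := IsAlgClosure.isAlgClosed F
  have hprime : Fact p.Prime := ⟨hp⟩
  have hζK : ζ ∈ F⟮ζ⟯ := mem_adjoin_simple_self F ζ
  have hgal : IsGalois F F⟮ζ⟯ := isGalois_adjoin_simple_of_isPrimitiveRoot hp hpF hζ
  have hfin : FiniteDimensional F F⟮ζ⟯ :=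
    adjoin.finiteDimensional (isIntegral_of_isPrimitiveRoot hp hζ)
  have hcop : (Module.finrank F F⟮ζ⟯).Coprime p :=
    finrank_adjoin_simple_coprime_of_isPrimitiveRoot hp hζ
  have hgen : ∀ E : IntermediateField F Ω, IsGalois F E → Module.finrank F E = p →
      relfinrank F⟮ζ⟯ (E ⊔ F⟮ζ⟯) = p ∧
        ∃ x ∈ E ⊔ F⟮ζ⟯, x ∉ F⟮ζ⟯ ∧ ∃ a : F⟮ζ⟯ˣ, x ^ p = ((a : F⟮ζ⟯) : Ω) := by
    intro E _ hEp
    obtain ⟨hrel, x, hxL, hx, hxp⟩ :=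
      exists_notMem_pow_mem_of_coprime hp hζ hζK hEp hcop
    have hx0 : x ^ p ≠ 0 := pow_ne_zero _ fun h => hx (h ▸ zero_mem _)
    exact ⟨hrel, x, hxL, hx,
      Units.mk0 ⟨x ^ p, hxp⟩ fun h => hx0 (congrArg Subtype.val h), rfl⟩
  let φ : {E : IntermediateField F Ω //
        IsGalois F ↥E ∧ IsCyclic (↥E ≃ₐ[F] ↥E) ∧ Module.finrank F ↥E = p} →
      {D : Subgroup (KmodP p ↥(adjoin F {ζ})) //
        Nat.card D = p ∧ (D : Set (KmodP p ↥(adjoin F {ζ}))) ⊆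
          omegaEigenspace p F ↥(adjoin F {ζ}) ω} := fun E =>
    ⟨kummerSubgroup F⟮ζ⟯ (E.1 ⊔ F⟮ζ⟯) p, by
      obtain ⟨E, hE, hcyc, hEp⟩ := E
      obtain ⟨hrel, x, hxL, hx, a, hxa⟩ := hgen E hE hEp
      refine ⟨card_kummerSubgroup hp hζ hζK le_sup_right hrel hxL hx hxa, fun c hc => ?_⟩
      obtain ⟨b, ⟨z, hzL, hzb⟩, rfl⟩ := mem_kummerSubgroup_iff.1 hc
      exact ⟨b, rfl, fun σ =>
        exists_apply_eq_pow_mul_pow hp hζ hζK hrel σ (hω σ) b.ne_zero hzL hzb⟩⟩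
  have hroot : ∀ E (a : F⟮ζ⟯ˣ), (QuotientGroup.mk a : KmodP p F⟮ζ⟯) ∈ (φ E).1 →
      (QuotientGroup.mk a : KmodP p F⟮ζ⟯) ≠ 1 → ∀ x : Ω, x ^ p = ((a : F⟮ζ⟯) : Ω) →
        E.1 ⊔ F⟮ζ⟯ = F⟮ζ⟯ ⊔ F⟮x⟯ := by
    intro E a ha ha1 x hxa
    obtain ⟨z, hzL, hza⟩ := (mk_mem_kummerSubgroup_iff le_sup_right).1 ha
    have hxL : x ∈ E.1 ⊔ F⟮ζ⟯ := mem_of_pow_eq_pow hp hζ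
      ((le_sup_right : F⟮ζ⟯ ≤ _) hζK) hzL (hxa.trans hza.symm)
    exact (sup_adjoin_simple_eq_of_relfinrank_prime hp le_sup_right
      (hgen E.1 E.2.1 E.2.2.2).1 hxL ((mk_ne_one_iff_notMem hp hζ hζK hxa).1 ha1)).symm
  have hinj : Function.Injective φ := by
    intro E E' h
    obtain ⟨hrel, x, hxL, hx, a, hxa⟩ := hgen E.1 E.2.1 E.2.2.2
    have ha1 := (mk_ne_one_iff_notMem hp hζ hζK hxa).2 hx
    have ha : (QuotientGroup.mk a : KmodP p F⟮ζ⟯) ∈ (φ E).1 :=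
      (mk_mem_kummerSubgroup_iff le_sup_right).2 ⟨x, hxL, hxa⟩
    have hsup := (hroot E a ha ha1 x hxa).trans (hroot E' a (h ▸ ha) ha1 x hxa).symm
    have := E.2.1
    exact Subtype.ext (eq_of_sup_eq_sup_of_coprime hp E.2.2.2 E'.2.2.2 hcop hrel hsup)
  have hsurj : Function.Surjective φ := by
    rintro ⟨D, hD, hDV⟩
    have hbot : D ≠ ⊥ := by
      rintro rfl
      exact hp.ne_one (hD.symm.trans Subgroup.card_bot)
    obtain ⟨c, hcD, hc⟩ := D.bot_or_exists_ne_one.resolve_left hbot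
    obtain ⟨a, rfl, ha⟩ := hDV hcD
    obtain ⟨x, hxa⟩ := IsAlgClosed.exists_pow_nat_eq ((a : F⟮ζ⟯) : Ω) hp.pos
    obtain ⟨E, hE, hEp, hEK⟩ := exists_isGalois_sup_eq_of_eigen hp hpF hζ hζK hcop
      ((mk_ne_one_iff_notMem hp hζ hζK hxa).1 hc) hxa fun σ => ⟨_, hω σ, ha σ⟩
    have : FiniteDimensional F E := FiniteDimensional.of_finrank_pos (hEp ▸ hp.pos)
    have hcyc : IsCyclic (E ≃ₐ[F] E) :=
      isCyclic_of_prime_card (p := p) (by rw [IsGalois.card_aut_eq_finrank, hEp])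
    refine ⟨⟨E, hE, hcyc, hEp⟩, Subtype.ext ?_⟩
    have hcE : QuotientGroup.mk a ∈ kummerSubgroup F⟮ζ⟯ (E ⊔ F⟮ζ⟯) p := by
      refine (mk_mem_kummerSubgroup_iff le_sup_right).2 ⟨x, ?_, hxa⟩
      rw [hEK]
      exact (le_sup_right : F⟮x⟯ ≤ _) (mem_adjoin_simple_self F x)
    exact (eq_zpowers_of_card_eq hp (φ ⟨E, hE, hcyc, hEp⟩).2.1 hcE hc).trans
      (eq_zpowers_of_card_eq hp hD hcD hc).symm
  exact ⟨Equiv.ofBijective φ ⟨hinj, hsurj⟩, fun E a ha ha1 x hxa => hroot E a ha ha1 x hxa⟩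
end

section
/- If x ∈ K^× is such that its class x̄ modulo (K^×)^p lies in V, then w(x) ≡ 0 (mod p), and consequently x̄ ∈ Ū_1; that is, V ⊆ Ū_1. -/
/-- A `p`-adic integer congruent to `1` modulo `p` is an `n`-th power for all `n` prime to `p`. -/
theorem PadicInt.exists_pow_eq_of_norm_sub_one_lt_one {p : ℕ} [Fact p.Prime] {u : ℤ_[p]}
    (hu : ‖u - 1‖ < 1) {n : ℕ} (hn : p.Coprime n) : ∃ z : ℤ_[p], z ^ n = u := by
  have hn1 : ‖(n : ℤ_[p])‖ = 1 := by
    rw [PadicInt.norm_natCast_eq_one_iff]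
    exact hn
  obtain ⟨z, hz, -⟩ := hensels_lemma (p := p) (R := ℤ_[p])
    (F := (Polynomial.X ^ n - Polynomial.C u : Polynomial ℤ_[p])) (a := (1 : ℤ_[p])) (by
      simpa [hn1, norm_sub_rev, Polynomial.derivative_X_pow] using hu)
  exact ⟨z, by simpa [sub_eq_zero] using hz⟩

/-- A homomorphism from `ℚ_pˣ` to `ℤ` (no continuity is assumed) is trivial on elements
of norm one. -/
theorem Padic.map_eq_zero_of_norm_eq_one {p : ℕ} [Fact p.Prime] {v : ℚ_[p] → ℤ}
    (hv : ∀ x y : ℚ_[p], x ≠ 0 → y ≠ 0 → v (x * y) = v x + v y) {x : ℚ_[p]} (hx : ‖x‖ = 1) :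
    v x = 0 := by
  have hone : v 1 = 0 := by
    have := hv 1 1 one_ne_zero one_ne_zero
    rw [mul_one] at this
    omega
  have hpow (x : ℚ_[p]) (hx : x ≠ 0) (n : ℕ) : v (x ^ n) = n * v x := by
    induction n with
    | zero => simp [hone]
    | succ n ih =>
      rw [pow_succ, hv _ _ (pow_ne_zero n hx) hx, ih]
      push_cast
      ring
  have key (u : ℤ_[p]) (hu : ‖u - 1‖ < 1) (hu0 : u ≠ 0) : v u = 0 := by
    set n := p * (v u).natAbs + 1 with hn
    obtain ⟨z, hz⟩ := PadicInt.exists_pow_eq_of_norm_sub_one_lt_one hu (n := n) (by simp [hn])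
    have hz0 : (z : ℚ_[p]) ≠ 0 := by
      intro h
      apply hu0
      rw [← hz, PadicInt.coe_eq_zero.1 h, zero_pow (by omega)]
    have h1 : v u = n * v z := by
      rw [← hz]
      push_cast
      exact hpow _ hz0 n
    refine Int.eq_zero_of_dvd_of_natAbs_lt_natAbs ⟨_, h1⟩ ?_
    have := (Fact.out : p.Prime).pos
    simp only [Int.natAbs_natCast, hn]
    nlinarith
  set u : ℤ_[p] := ⟨x, hx.le⟩
  have hu : ‖u‖ = 1 := hx
  have hu0 : u ≠ 0 := by
    intro h
    simp [h] at hu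
  have hx0 : x ≠ 0 := by
    rintro rfl
    simp at hx
  have hres : ‖u ^ (p - 1) - 1‖ < 1 := by
    have hmem (y : ℤ_[p]) : PadicInt.toZMod y = 0 ↔ ‖y‖ < 1 := by
      rw [← RingHom.mem_ker, PadicInt.ker_toZMod, IsLocalRing.mem_maximalIdeal,
        PadicInt.mem_nonunits]
    rw [← hmem, map_sub, map_pow, map_one, sub_eq_zero]
    apply ZMod.pow_card_sub_one_eq_one
    rw [Ne, hmem, hu]
    exact lt_irrefl 1
  have h := key _ hres (pow_ne_zero _ hu0)
  have h2 : v (x ^ (p - 1)) = 0 := by rwa [PadicInt.coe_pow] at h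
  rw [hpow x hx0] at h2
  have := (Fact.out : p.Prime).two_le
  rcases mul_eq_zero.1 h2 with h3 | h3
  · omega
  · exact h3

/-- A homomorphism from `ℚ_pˣ` to `ℤ` is a multiple of the `p`-adic valuation. -/
theorem Padic.map_eq_valuation_mul {p : ℕ} [Fact p.Prime] {v : ℚ_[p] → ℤ}
    (hv : ∀ x y : ℚ_[p], x ≠ 0 → y ≠ 0 → v (x * y) = v x + v y) {x : ℚ_[p]} (hx : x ≠ 0) :
    v x = x.valuation * v p := by
  have hp : (p : ℚ_[p]) ≠ 0 := by exact_mod_cast (Fact.out : p.Prime).ne_zero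
  have hp' : (p : ℝ) ≠ 0 := by exact_mod_cast (Fact.out : p.Prime).ne_zero
  have hnat (n : ℕ) : v ((p : ℚ_[p]) ^ n) = n * v p := by
    induction n with
    | zero =>
      have := hv 1 1 one_ne_zero one_ne_zero
      rw [mul_one] at this
      simp
      omega
    | succ n ih =>
      rw [pow_succ, hv _ _ (pow_ne_zero n hp) hp, ih]
      push_cast
      ring
  have hint (n : ℤ) : v ((p : ℚ_[p]) ^ n) = n * v p := by
    obtain ⟨n, rfl | rfl⟩ := n.eq_nat_or_neg
    · simpa using hnat n
    · have h := hv _ _ (zpow_ne_zero (-n : ℤ) hp) (pow_ne_zero n hp)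
      rw [← zpow_natCast, ← zpow_add₀ hp, neg_add_cancel, zpow_natCast, hnat] at h
      have h0 := hnat 0
      simp only [pow_zero, zpow_zero, Nat.cast_zero, zero_mul] at h h0
      linarith
  have hunit : v (x * (p : ℚ_[p]) ^ (-x.valuation)) = 0 := by
    apply Padic.map_eq_zero_of_norm_eq_one hv
    rw [norm_mul, norm_zpow, Padic.norm_eq_zpow_neg_valuation hx, Padic.norm_p, inv_zpow,
      ← zpow_neg, ← zpow_add₀ hp']
    simp
  rw [hv _ _ hx (zpow_ne_zero _ hp), hint] at hunit
  linarith

/-- The residue field of a locally compact ultrametric field with `‖p‖ < 1` is perfect. -/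
theorem exists_norm_sub_pow_lt_one {K : Type*} [NormedField K] [ProperSpace K]
    [IsUltrametricDist K] {p : ℕ} (hp : p.Prime) (hpK : ‖(p : K)‖ < 1) {u : K} (hu : ‖u‖ ≤ 1) :
    ∃ b : K, ‖u - b ^ p‖ < 1 := by
  obtain ⟨n, k, hk, hnk⟩ : ∃ n k : ℕ, 0 < k ∧ ‖u ^ p ^ (n + k) - u ^ p ^ n‖ < 1 := by
    obtain ⟨a, -, φ, hφ, hlim⟩ := (isCompact_closedBall (0 : K) 1).tendsto_subseq
      (x := fun n => u ^ p ^ n) (fun n => by simpa using pow_le_one₀ (norm_nonneg u) hu)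
    obtain ⟨N, hN⟩ := Metric.cauchySeq_iff.1 hlim.cauchySeq 1 one_pos
    refine ⟨φ N, φ (N + 1) - φ N, Nat.sub_pos_of_lt (hφ N.lt_succ_self), ?_⟩
    rw [Nat.add_sub_cancel' (hφ N.lt_succ_self).le, ← dist_eq_norm]
    exact hN _ N.le_succ _ le_rfl
  refine ⟨u ^ p ^ (k - 1), ?_⟩
  rw [← pow_mul, ← pow_succ, Nat.sub_add_cancel hk]
  have hmem (x : K) : x ∈ (NormedField.valuation (K := K)).integer ↔ ‖x‖ ≤ 1 := Iff.rfl
  set U : (NormedField.valuation (K := K)).integer := ⟨u, hu⟩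
  obtain ⟨r, hr⟩ := exists_add_pow_prime_pow_eq hp (U - U ^ p ^ k) (U ^ p ^ k) n
  have hr' := congrArg (Subtype.val : _ → K) hr
  simp only [sub_add_cancel, ← pow_mul, ← pow_add] at hr'
  push_cast at hr'
  have hr1 : ‖(r : K)‖ ≤ 1 := r.2
  have hUu : (U : K) = u := rfl
  rw [hUu] at hr'
  set d := u - u ^ p ^ k
  have hd : ‖d‖ ≤ 1 := (U - U ^ p ^ k).2
  have hpd : ‖(p : K) * d * u ^ p ^ k * r‖ < 1 := by
    rw [mul_assoc, mul_assoc, norm_mul]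
    refine mul_lt_one_of_nonneg_of_lt_one_left (norm_nonneg _) hpK ?_
    rw [norm_mul, norm_mul, norm_pow]
    exact mul_le_one₀ hd (by positivity)
      (mul_le_one₀ (pow_le_one₀ (norm_nonneg u) hu) (norm_nonneg _) hr1)
  have hdn : d ^ p ^ n =
      -((p : K) * d * u ^ p ^ k * r + (u ^ p ^ (n + k) - u ^ p ^ n)) := by
    rw [add_comm n k]
    linear_combination -hr'
  have hlt : ‖d ^ p ^ n‖ < 1 := by
    rw [hdn, norm_neg]
    exact (IsUltrametricDist.norm_add_le_max _ _).trans_lt (max_lt hpd hnk)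
  rw [norm_pow] at hlt
  exact (pow_lt_one_iff_of_nonneg (norm_nonneg _) (pow_ne_zero _ hp.ne_zero)).1 hlt

/-- The absolute value `x ↦ c ^ (-w x)` attached to a discrete valuation `w` and a real `c > 1`. -/
noncomputable def absoluteValueOfValuation {K : Type*} [Field K] (w : K → ℤ)
    (hwmul : ∀ x y : K, x ≠ 0 → y ≠ 0 → w (x * y) = w x + w y)
    (hwadd : ∀ x y : K, x ≠ 0 → y ≠ 0 → x + y ≠ 0 → min (w x) (w y) ≤ w (x + y))
    (c : ℝ) (hc : 1 < c) : AbsoluteValue K ℝ where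
  toFun x := open Classical in if x = 0 then 0 else c ^ (-w x)
  map_mul' x y := by
    by_cases hx : x = 0
    · simp [hx]
    by_cases hy : y = 0
    · simp [hy]
    simp only [hx, hy, mul_eq_zero, or_self, if_false, hwmul x y hx hy]
    rw [← zpow_add₀ (by positivity), neg_add]
  nonneg' x := by
    split_ifs <;> positivity
  eq_zero' x := by
    have := fun n : ℤ => (zpow_pos (zero_lt_one.trans hc) n).ne'
    by_cases hx : x = 0 <;> simp [hx, this]
  add_le' x y := by
    have hc0 : 0 < c := zero_lt_one.trans hc
    by_cases hx : x = 0
    · rw [hx, zero_add, if_pos rfl, zero_add]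
    by_cases hy : y = 0
    · rw [hy, add_zero, if_pos rfl, add_zero]
    have hx' := zpow_pos hc0 (-w x)
    have hy' := zpow_pos hc0 (-w y)
    by_cases hxy : x + y = 0
    · simp only [hx, hy, hxy, if_true, if_false]
      positivity
    simp only [hx, hy, hxy, if_false]
    rcases min_le_iff.1 (hwadd x y hx hy hxy) with h | h
    · have := zpow_le_zpow_right₀ hc.le (neg_le_neg h)
      linarith
    · have := zpow_le_zpow_right₀ hc.le (neg_le_neg h)
      linarith

theorem absoluteValueOfValuation_apply {K : Type*} [Field K] {w : K → ℤ}
    (hwmul : ∀ x y : K, x ≠ 0 → y ≠ 0 → w (x * y) = w x + w y)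
    (hwadd : ∀ x y : K, x ≠ 0 → y ≠ 0 → x + y ≠ 0 → min (w x) (w y) ≤ w (x + y))
    {c : ℝ} (hc : 1 < c) {x : K} (hx : x ≠ 0) :
    absoluteValueOfValuation w hwmul hwadd c hc x = c ^ (-w x) :=
  if_neg hx

/-- A discrete valuation `w` with `w p > 0` on an algebraic extension of `ℚ_p` is given by
the spectral norm. -/
theorem exists_spectralNorm_eq_zpow {p : ℕ} [Fact p.Prime] {K : Type*} [Field K]
    [Algebra ℚ_[p] K] [Algebra.IsAlgebraic ℚ_[p] K] {w : K → ℤ}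
    (hwmul : ∀ x y : K, x ≠ 0 → y ≠ 0 → w (x * y) = w x + w y)
    (hwadd : ∀ x y : K, x ≠ 0 → y ≠ 0 → x + y ≠ 0 → min (w x) (w y) ≤ w (x + y))
    (hwp : 0 < w p) :
    ∃ c : ℝ, 1 < c ∧ ∀ x : K, x ≠ 0 → spectralNorm ℚ_[p] K x = c ^ (-w x) := by
  have hp1 : (1 : ℝ) < p := by exact_mod_cast (Fact.out : p.Prime).one_lt
  have hN : (0 : ℝ) < (w p : ℝ) := by exact_mod_cast hwp
  set c : ℝ := (p : ℝ) ^ (1 / (w p : ℝ)) with hcdef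
  have hc : 1 < c := Real.one_lt_rpow hp1 (by positivity)
  have hcp : c ^ (w p) = p := by
    rw [← Real.rpow_intCast, hcdef, ← Real.rpow_mul (by positivity), one_div_mul_cancel hN.ne',
      Real.rpow_one]
  refine ⟨c, hc, fun x hx => ?_⟩
  rw [← absoluteValueOfValuation_apply hwmul hwadd hc hx]
  refine (spectralNorm_unique_field_norm_ext (fun z => ?_) x).symm
  by_cases hz : z = 0
  · simp [hz]
  have hz' : algebraMap ℚ_[p] K z ≠ 0 := by simpa using hz
  rw [absoluteValueOfValuation_apply hwmul hwadd hc hz',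
    Padic.map_eq_valuation_mul (v := fun z => w (algebraMap ℚ_[p] K z)) (fun a b ha hb => by
      rw [map_mul]
      exact hwmul _ _ (by simpa using ha) (by simpa using hb)) hz,
    Padic.norm_eq_zpow_neg_valuation hz, map_natCast, ← neg_mul, mul_comm, zpow_mul, hcp]

/-- If `F` has no primitive `n`-th root of unity, some automorphism of `F(ζ)` over `F`
moves `ζ`. -/
theorem IsPrimitiveRoot.exists_algEquiv_apply_ne {F K : Type*} [Field F] [Field K] [Algebra F K]
    {n : ℕ} [NeZero n] {ζ : K} (hζ : IsPrimitiveRoot ζ n)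
    (hreg : ¬ ∃ z : F, IsPrimitiveRoot z n) [IsCyclotomicExtension {n} F K] :
    ∃ σ : K ≃ₐ[F] K, σ ζ ≠ ζ := by
  by_contra! h
  have := IsCyclotomicExtension.isGalois {n} F K
  obtain ⟨z, hz⟩ := IntermediateField.mem_bot.1 ((InfiniteGalois.mem_bot_iff_fixed ζ).2 h)
  rw [← hz] at hζ
  exact hreg ⟨z, hζ.of_map_of_injective (algebraMap F K).injective⟩


/-- `V ⊆ Ū₁`: if the class of `x ∈ Kˣ` lies in the `ω`-eigenspace `V` of `Kˣ/(Kˣ)ᵖ`,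
then `w x ≡ 0 (mod p)` and the class of `x` lies in `Ū₁`. -/
theorem statement5 (p : ℕ) [hp : Fact p.Prime] (hodd : Odd p)
    (F : Type*) [Field F] [Algebra ℚ_[p] F] [FiniteDimensional ℚ_[p] F]
    (hreg : ¬ ∃ z : F, IsPrimitiveRoot z p)
    (K : Type*) [Field K] [Algebra F K]
    (ζ : K) (hζ : IsPrimitiveRoot ζ p)
    (hKgen : IntermediateField.adjoin F {ζ} = ⊤)
    (ω : (K ≃ₐ[F] K) → (ZMod p)ˣ)
    (hω : ∀ σ : K ≃ₐ[F] K, σ ζ = ζ ^ (ω σ : ZMod p).val)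
    (w : K → ℤ) (hw0 : w 0 = 0)
    (hwmul : ∀ x y : K, x ≠ 0 → y ≠ 0 → w (x * y) = w x + w y)
    (hwadd : ∀ x y : K, x ≠ 0 → y ≠ 0 → x + y ≠ 0 → min (w x) (w y) ≤ w (x + y))
    (hwsurj : ∃ π : K, π ≠ 0 ∧ w π = 1)
    (s : ℕ) (hs : 0 < s)
    (hsdvd : ∀ z : F, z ≠ 0 → (s : ℤ) ∣ w (algebraMap F K z))
    (hsval : ∃ z : F, z ≠ 0 ∧ w (algebraMap F K z) = (s : ℤ))
    (e : ℕ) (he : 0 < e) (hew : w (algebraMap F K (p : F)) = (e * s : ℕ))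
    (f : ℕ) (hf : 0 < f) (hef : e * f = Module.finrank ℚ_[p] F)
    (e1s : ℕ) (he1s : (p - 1) * e1s = e * s)
    :
    ∀ x : Kˣ,
      (∀ σ : K ≃ₐ[F] K, ∃ y : K, y ≠ 0 ∧ σ (x : K) = (x : K) ^ (ω σ : ZMod p).val * y ^ p) →
      ((p : ℤ) ∣ w (x : K) ∧
        ∃ u y : K, y ≠ 0 ∧ (u - 1 = 0 ∨ 1 ≤ w (u - 1)) ∧ (x : K) = u * y ^ p) := by
  have hpp : p.Prime := hp.out
  have hcyc : IsCyclotomicExtension {p} F K := by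
    have := (IntermediateField.isCyclotomicExtension_singleton_iff_eq_adjoin p F K ⊤ hζ).2
      hKgen.symm
    exact IsCyclotomicExtension.equiv {p} F _ IntermediateField.topEquiv
  have := IsCyclotomicExtension.finiteDimensional {p} F K
  let : Algebra ℚ_[p] K := ((algebraMap F K).comp (algebraMap ℚ_[p] F)).toAlgebra
  have : IsScalarTower ℚ_[p] F K := IsScalarTower.of_algebraMap_eq fun _ => rfl
  have : FiniteDimensional ℚ_[p] K := FiniteDimensional.trans ℚ_[p] F K
  have hwp : 0 < w p := by
    rw [← map_natCast (algebraMap F K), hew]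
    positivity
  obtain ⟨c, hc, hcw⟩ := exists_spectralNorm_eq_zpow hwmul hwadd hwp
  have hwσ (σ : K ≃ₐ[F] K) {x : K} (hx : x ≠ 0) : w (σ x) = w x := by
    have h := spectralNorm_eq_of_equiv (σ.restrictScalars ℚ_[p]) x
    rw [AlgEquiv.restrictScalars_apply, hcw x hx, hcw _ (by simpa using hx)] at h
    have := zpow_right_injective₀ (zero_lt_one.trans hc) hc.ne' h
    omega
  have hone : w 1 = 0 := by
    have := hwmul 1 1 one_ne_zero one_ne_zero
    rw [mul_one] at this
    omega
  have hpow {x : K} (hx : x ≠ 0) (n : ℕ) : w (x ^ n) = n * w x := by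
    induction n with
    | zero => simp [hone]
    | succ n ih =>
      rw [pow_succ, hwmul _ _ (pow_ne_zero n hx) hx, ih]
      push_cast
      ring
  have hinv {x : K} (hx : x ≠ 0) : w x⁻¹ = -w x := by
    have := hwmul x x⁻¹ hx (inv_ne_zero hx)
    rw [mul_inv_cancel₀ hx, hone] at this
    omega
  intro x hV
  have hx : (x : K) ≠ 0 := x.ne_zero
  have hdvd : (p : ℤ) ∣ w (x : K) := by
    obtain ⟨σ, hσ⟩ := hζ.exists_algEquiv_apply_ne hreg
    obtain ⟨y, hy, hxy⟩ := hV σ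
    have h := hwσ σ hx
    rw [hxy, hwmul _ _ (pow_ne_zero _ hx) (pow_ne_zero _ hy), hpow hx, hpow hy] at h
    have hmul : (p : ℤ) ∣ (((ω σ : ZMod p).val : ℤ) - 1) * w (x : K) :=
      ⟨-w y, by linear_combination h⟩
    refine ((Nat.prime_iff_prime_int.1 hpp).dvd_or_dvd hmul).resolve_left fun hd => hσ ?_
    have h1 : (ω σ : ZMod p) = 1 := by
      have := (ZMod.intCast_zmod_eq_zero_iff_dvd _ p).2 hd
      simpa [sub_eq_zero] using this
    have := Fact.mk hpp.one_lt
    rw [hω, h1, ZMod.val_one, pow_one]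
  refine ⟨hdvd, ?_⟩
  obtain ⟨m, hm⟩ := hdvd
  obtain ⟨t, ht, hwt⟩ : ∃ t : K, t ≠ 0 ∧ w t = m := by
    obtain ⟨π, hπ, hwπ⟩ := hwsurj
    obtain ⟨n, rfl | rfl⟩ := m.eq_nat_or_neg
    · exact ⟨π ^ n, pow_ne_zero n hπ, by rw [hpow hπ, hwπ, mul_one]⟩
    · refine ⟨(π ^ n)⁻¹, inv_ne_zero (pow_ne_zero n hπ), ?_⟩
      rw [hinv (pow_ne_zero n hπ), hpow hπ, hwπ, mul_one]
  set v : K := x * (t ^ p)⁻¹ with hvdef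
  have htp := pow_ne_zero p ht
  have hv0 : v ≠ 0 := mul_ne_zero hx (inv_ne_zero htp)
  have hwv : w v = 0 := by
    rw [hvdef, hwmul _ _ hx (inv_ne_zero htp), hinv htp, hpow ht, hwt, hm]
    ring
  have hpos {z : K} (hz : z ≠ 0) (h : spectralNorm ℚ_[p] K z < 1) : 1 ≤ w z := by
    rw [hcw z hz, zpow_lt_one_iff_right₀ hc] at h
    omega
  obtain ⟨b, hb⟩ : ∃ b : K, spectralNorm ℚ_[p] K (v - b ^ p) < 1 := by
    let := spectralNorm.normedField ℚ_[p] K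
    let := spectralNorm.normedAlgebra ℚ_[p] K
    have : ProperSpace K := FiniteDimensional.proper ℚ_[p] K
    have : IsUltrametricDist K :=
      IsUltrametricDist.isUltrametricDist_of_isNonarchimedean_norm
        (isNonarchimedean_spectralNorm (K := ℚ_[p]) (L := K))
    refine exists_norm_sub_pow_lt_one hpp ?_ ?_
    · change spectralNorm ℚ_[p] K p < 1
      rw [hcw _ (by intro h; rw [h, hw0] at hwp; exact lt_irrefl _ hwp),
        zpow_lt_one_iff_right₀ hc]
      omega
    · change spectralNorm ℚ_[p] K v ≤ 1
      simp [hcw v hv0, hwv]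
  have hb0 : b ≠ 0 := by
    rintro rfl
    rw [zero_pow hpp.ne_zero, sub_zero, hcw v hv0, hwv] at hb
    simp at hb
  have hbp := pow_ne_zero p hb0
  have hwb : w (b ^ p) ≤ 0 := by
    by_contra! h
    by_cases hd : v - b ^ p = 0
    · rw [← sub_eq_zero.1 hd] at h
      omega
    have h1 := hpos hd hb
    have h2 := hwadd _ _ hd hbp (by simpa using hv0)
    rw [sub_add_cancel, hwv] at h2
    omega
  refine ⟨v * (b ^ p)⁻¹, t * b, mul_ne_zero ht hb0, ?_, ?_⟩
  · by_cases hd : v - b ^ p = 0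
    · left
      rw [sub_eq_zero.1 hd, mul_inv_cancel₀ hbp, sub_self]
    · right
      have h : v * (b ^ p)⁻¹ - 1 = (v - b ^ p) * (b ^ p)⁻¹ := by
        field_simp
      rw [h, hwmul _ _ hd (inv_ne_zero hbp), hinv hbp]
      have := hpos hd hb
      omega
  · rw [hvdef, mul_pow]
    field_simp
end

section
/- One has Ū_{pe₁s} ⊆ V: for every u ∈ O_K^× with u ≡ 1 (mod 𝔓^{pe₁s}) and every σ ∈ Δ, σ(u)·u^{−ω(σ)} ∈ (K^×)^p. -/
theorem FiniteField.exists_pow_sub_self_eq_map_sub_self {k : Type*} [Field k] [Finite k] (p : ℕ)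
    [Fact p.Prime] [CharP k p] (τ : k →+* k) (x : k) : ∃ z, z ^ p - z = τ x - x := by
  let : Algebra (ZMod p) k := ZMod.algebra k p
  have hτ : τ.comp (algebraMap (ZMod p) k) = algebraMap (ZMod p) k := Subsingleton.elim _ _
  let τ' : k →ₐ[ZMod p] k := { τ with commutes' := DFunLike.congr_fun hτ }
  obtain ⟨⟨n, hlt⟩, hn⟩ := (FiniteField.bijective_frobeniusAlgHom_pow (ZMod p) k).2 τ'
  have key : ∀ (m : ℕ), ∃ z, z ^ p - z = (FiniteField.frobeniusAlgHom (ZMod p) k ^ m) x - x := by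
    intro m
    induction m with
    | zero => exact ⟨0, by simp [(Fact.out : p.Prime).ne_zero]⟩
    | succ m ih =>
      obtain ⟨z, hz⟩ := ih
      refine ⟨z + (FiniteField.frobeniusAlgHom (ZMod p) k ^ m) x, ?_⟩
      rw [add_pow_char, pow_succ', AlgHom.mul_apply, FiniteField.frobeniusAlgHom_apply,
        ZMod.card]
      linear_combination hz
  obtain ⟨z, hz⟩ := key n
  exact ⟨z, hz.trans (by rw [show FiniteField.frobeniusAlgHom (ZMod p) k ^ n = τ' from hn]; rfl)⟩

section Henselian

open IsLocalRing Polynomial Finset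

variable {O : Type*} [CommRing O] (p : ℕ) [Fact p.Prime]

theorem sum_zero_pow_mul_choose_div {k : Type*} [CommRing k] :
    ∑ i ∈ Ioo 0 p, (0 : k) ^ (i - 1) * ((p.choose i / p : ℕ) : k) = 1 := by
  have hp : p.Prime := Fact.out
  rw [sum_eq_single_of_mem 1 (by simp [hp.one_lt])]
  · simp [Nat.div_self hp.pos]
  · intro i hi h1
    rw [mem_Ioo] at hi
    rw [zero_pow (by omega), zero_mul]

/-- With `l = 1 - ζ`, one has `p = l ^ (p - 1) * ε` with `ε ≡ -1` modulo the maximal ideal. -/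
theorem IsPrimitiveRoot.exists_eq_one_sub_pow_mul [IsDomain O] [IsLocalRing O]
    [CharP (ResidueField O) p] (hodd : Odd p) {ζ : O} (hζ : IsPrimitiveRoot ζ p) :
    residue O (1 - ζ) = 0 ∧
      ∃ ε : O, residue O ε = -1 ∧ (p : O) = (1 - ζ) ^ (p - 1) * ε := by
  have hp : p.Prime := Fact.out
  have hl : residue O (1 - ζ) = 0 := by
    have h : (residue O (1 - ζ)) ^ p = 0 := by
      rw [map_sub, sub_pow_char, ← map_pow, ← map_pow, hζ.pow_eq_one]
      simp
    exact pow_eq_zero_iff hp.ne_zero |>.1 h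
  refine ⟨hl, ?_⟩
  have hl0 : 1 - ζ ≠ 0 := sub_ne_zero.2 (hζ.ne_one hp.one_lt).symm
  have h := add_pow_prime_eq hp (-(1 - ζ)) 1
  set S := ∑ k ∈ Ioo 0 p, (-(1 - ζ)) ^ (k - 1) * 1 ^ (p - k - 1) * ((p.choose k / p : ℕ) : O)
  have hS : residue O S = 1 := by
    simp only [S, map_sum, map_mul, map_pow, map_neg, hl, neg_zero, one_pow, mul_one,
      map_natCast]
    exact sum_zero_pow_mul_choose_div p
  have hSu : IsUnit S := by
    rw [← residue_ne_zero_iff_isUnit, hS]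
    exact one_ne_zero
  obtain ⟨v, hv⟩ := hSu
  rw [← hv] at h hS
  refine ⟨-(v⁻¹ : Oˣ), ?_, ?_⟩
  · have : residue O v * residue O (v⁻¹ : Oˣ) = 1 := by rw [← map_mul]; simp
    rw [map_neg]
    rw [hS, one_mul] at this
    rw [this]
  · rw [show -(1 - ζ) + 1 = ζ by ring, hζ.pow_eq_one, hodd.neg_pow] at h
    have h2 : (1 - ζ) * (1 - ζ) ^ (p - 1) = (1 - ζ) ^ p := mul_pow_sub_one hp.ne_zero _
    have h3 : (1 - ζ) * ((p : O) * v) = (1 - ζ) * (- (1 - ζ) ^ (p - 1)) := by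
      linear_combination h + h2
    have h4 := mul_left_cancel₀ hl0 h3
    calc (p : O) = p * (v * (v⁻¹ : Oˣ)) := by simp
      _ = _ := by linear_combination (↑v⁻¹ : O) * h4

theorem HenselianLocalRing.exists_pow_eq_one_add [HenselianLocalRing O]
    [CharP (ResidueField O) p] {l ε : O} (hl : residue O l = 0) (hε : residue O ε = -1)
    (h : (p : O) = l ^ (p - 1) * ε) {b : O} {z : ResidueField O}
    (hz : z ^ p - z = residue O b) :
    ∃ y, IsUnit y ∧ y ^ p = 1 + l ^ p * b := by
  have hp : p.Prime := Fact.out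
  let S : O[X] := ∑ k ∈ Ioo 0 p, (C l * X) ^ (k - 1) * C ((p.choose k / p : ℕ) : O)
  have hSmap : S.map (residue O) = 1 := by
    simp only [S, Polynomial.map_sum, Polynomial.map_mul, Polynomial.map_pow, map_C, map_X, hl,
      map_zero, zero_mul, map_natCast, Polynomial.map_natCast]
    exact sum_zero_pow_mul_choose_div p
  have hSdeg : S.natDegree ≤ p - 2 := by
    refine natDegree_sum_le_of_forall_le _ _ fun k hk ↦ ?_
    rw [mem_Ioo] at hk
    refine natDegree_mul_le.trans ?_
    rw [natDegree_C, add_zero]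
    refine natDegree_pow_le.trans ?_
    have : (C l * X : O[X]).natDegree ≤ 1 := (natDegree_C_mul_le _ _).trans natDegree_X_le
    calc (k - 1) * (C l * X : O[X]).natDegree ≤ (k - 1) * 1 := by gcongr
      _ ≤ _ := by omega
  let g : O[X] := X ^ p + (C ε * X * S - C b)
  have hgm : g.Monic := by
    have h2 := hp.two_le
    refine monic_X_pow_add (lt_of_le_of_lt degree_le_natDegree (Nat.cast_lt.2
      (lt_of_le_of_lt (natDegree_sub_le _ _) ?_)))
    rw [natDegree_C, max_eq_left (Nat.zero_le _)]
    refine lt_of_le_of_lt natDegree_mul_le ?_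
    have : (C ε * X : O[X]).natDegree ≤ 1 := (natDegree_C_mul_le _ _).trans natDegree_X_le
    omega
  have hgmap : g.map (residue O) = X ^ p - X - C (residue O b) := by
    simp only [g, Polynomial.map_add, Polynomial.map_sub, Polynomial.map_mul, Polynomial.map_pow,
      map_X, map_C, hSmap, hε]
    simp only [map_neg, map_one]
    ring
  obtain ⟨z, rfl⟩ := residue_surjective z
  obtain ⟨y, hy, -⟩ := HenselianLocalRing.is_henselian g hgm z
    (by
      rw [← residue_eq_zero_iff, ← eval_map_apply, hgmap]
      simp [hz])
    (by
      rw [← residue_ne_zero_iff_isUnit, ← eval_map_apply, ← derivative_map, hgmap]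
      simp [derivative_X_pow])
  refine ⟨1 + l * y, ?_, ?_⟩
  · rw [← residue_ne_zero_iff_isUnit]
    simp [hl]
  · have h1 := add_pow_prime_eq hp (l * y) 1
    have hS : ∑ k ∈ Ioo 0 p, (l * y) ^ (k - 1) * 1 ^ (p - k - 1) * ((p.choose k / p : ℕ) : O)
        = S.eval y := by
      simp [S, eval_finsetSum]
    rw [hS] at h1
    have h2 : l * l ^ (p - 1) = l ^ p := mul_pow_sub_one hp.ne_zero _
    have hy' : y ^ p + (ε * y * S.eval y - b) = 0 := by
      simpa [g] using hy
    rw [add_comm, h1, mul_pow]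
    linear_combination l ^ p * hy' + (l * y * S.eval y) * h + (y * S.eval y * ε) * h2

theorem HenselianLocalRing.exists_map_eq_pow_mul_pow [IsDomain O] [HenselianLocalRing O]
    [CharP (ResidueField O) p] [Finite (ResidueField O)] (hodd : Odd p) {ζ : O}
    (hζ : IsPrimitiveRoot ζ p) (σ : O ≃+* O) {n : ℕ} (hσ : σ ζ = ζ ^ n) (a : O) :
    ∃ y, IsUnit y ∧
      σ (1 + (1 - ζ) ^ p * a) = (1 + (1 - ζ) ^ p * a) ^ n * y ^ p := by
  have hp : p.Prime := Fact.out
  obtain ⟨hl, ε, hε, hpε⟩ := hζ.exists_eq_one_sub_pow_mul p hodd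
  have hζ1 : residue O ζ = 1 := by
    rw [map_sub, map_one, sub_eq_zero] at hl
    exact hl.symm
  let k := ResidueField O
  have hu : IsUnit ((1 + (1 - ζ) ^ p * a) ^ n) := by
    rw [← residue_ne_zero_iff_isUnit]
    simp [hζ1, hp.ne_zero]
  obtain ⟨v, hv⟩ := hu.exists_right_inv
  obtain ⟨r, hr⟩ : ∃ r, (1 + (1 - ζ) ^ p * a) ^ n =
      1 + n * ((1 - ζ) ^ p * a) + ((1 - ζ) ^ p * a) ^ 2 * r := by
    generalize (1 - ζ) ^ p * a = x
    clear hσ hu hv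
    induction n with
    | zero => exact ⟨0, by simp⟩
    | succ n ih =>
      obtain ⟨r, hr⟩ := ih
      refine ⟨n + r * (1 + x), ?_⟩
      rw [pow_succ, hr]
      push_cast
      ring
  have hση : σ (1 - ζ) = (1 - ζ) * ∑ i ∈ range n, ζ ^ i := by
    rw [map_sub, map_one, hσ, mul_neg_geom_sum]
  set η := ∑ i ∈ range n, ζ ^ i
  let b := v * (η ^ p * σ a - n * a - (1 - ζ) ^ p * a ^ 2 * r)
  have hb : σ (1 + (1 - ζ) ^ p * a) = (1 + (1 - ζ) ^ p * a) ^ n * (1 + (1 - ζ) ^ p * b) := by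
    have : σ (1 + (1 - ζ) ^ p * a) = 1 + (1 - ζ) ^ p * η ^ p * σ a := by
      rw [map_add, map_mul, map_pow, hση, map_one, mul_pow]
    rw [this]
    linear_combination (-(1 - ζ) ^ p * (η ^ p * σ a - n * a - (1 - ζ) ^ p * a ^ 2 * r)) * hv - hr
  have hn : (n : k) ^ p = n := by
    rw [← frobenius_def, map_natCast]
  obtain ⟨z, hz⟩ := FiniteField.exists_pow_sub_self_eq_map_sub_self p
    (ResidueField.map (σ : O →+* O)) (residue O a)
  have hvr : residue O v = 1 := by
    have := congrArg (residue O) hv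
    simpa [hζ1, hp.ne_zero] using this
  have hbr : ((n : k) * z) ^ p - n * z = residue O b := by
    have h1 : residue O b = n * residue O (σ a) - n * residue O a := by
      simp [b, η, hvr, hζ1, hp.ne_zero, k, hn]
    rw [ResidueField.map_residue] at hz
    rw [h1, mul_pow, hn, ← mul_sub, hz, mul_sub]
    rfl
  obtain ⟨y, hy, hyp⟩ := HenselianLocalRing.exists_pow_eq_one_add p hl hε hpε hbr
  exact ⟨y, hy, by rw [hyp, hb]⟩

end Henselian

section ProperSpace

open IsLocalRing
open scoped NormedField Valued Pointwise

namespace Valued.integer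

variable {K : Type*} [NontriviallyNormedField K] [IsUltrametricDist K] [ProperSpace K]

theorem compactSpace_of_properSpace : CompactSpace 𝒪[K] := by
  refine isCompact_iff_compactSpace.1 ?_
  have : (𝒪[K] : Set K) = Metric.closedBall 0 1 := by
    ext x
    simpa using Valued.integer.mem_iff (x := x)
  rw [this]
  exact isCompact_closedBall 0 1

theorem isNontrivial_valuation {K : Type*} [NontriviallyNormedField K] [IsUltrametricDist K] :
    (Valued.v : Valuation K NNReal).IsNontrivial := by
  obtain ⟨x, h0, h1⟩ := NormedField.exists_norm_lt_one K
  exact Valuation.isNontrivial_iff_exists_lt_one _ |>.2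
   ⟨x, by simpa using h0, by rw [NormedField.v_eq_valuation]; simpa [← NNReal.coe_lt_coe] using h1⟩

theorem isAdicComplete_of_properSpace : IsAdicComplete 𝓂[K] 𝒪[K] := by
  have := compactSpace_of_properSpace (K := K)
  have := isNontrivial_valuation (K := K)
  have : IsDiscreteValuationRing 𝒪[K] := isDiscreteValuationRing_of_compactSpace
  exact
  { prec' f hf := by
      let S n : Set 𝒪[K] := f n +ᵥ ((𝓂[K] ^ n : Ideal 𝒪[K]) : Set 𝒪[K])
      have hS n : S (n + 1) ⊆ S n := by
        apply (Set.vadd_set_subset_vadd_set_iff.mpr (Ideal.pow_le_pow_right n.le_succ)).trans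
        simpa [S] using (hf n.le_succ).symm
      have h n : IsClosed (S n) := (IsNoetherianRing.isClosed_ideal (𝓂[K] ^ n)).vadd (f n)
      obtain ⟨L, hL⟩ := (h 0).isCompact.nonempty_iInter_of_sequence_nonempty_isCompact_isClosed S hS
        (by simp [S]) h
      refine ⟨L, fun n ↦ ?_⟩
      obtain ⟨y, hy, rfl⟩ := Set.mem_iInter.mp hL n
      simpa [SModEq.sub_mem] using hy }

theorem henselianLocalRing_of_properSpace : HenselianLocalRing 𝒪[K] := by
  have := isAdicComplete_of_properSpace (K := K)
  have := compactSpace_of_properSpace (K := K)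
  refine { is_henselian := fun f hf a h h' ↦ ?_ }
  exact HenselianRing.is_henselian (I := 𝓂[K]) f hf a h (h'.map _)

theorem finite_residueField_of_properSpace : Finite 𝓀[K] := by
  have := compactSpace_of_properSpace (K := K)
  have := isNontrivial_valuation (K := K)
  let : (Valued.v : Valuation K NNReal).RankOne :=
    inferInstanceAs (NormedField.valuation (K := K)).RankOne
  exact (compactSpace_iff_completeSpace_and_isDiscreteValuationRing_and_finite_residueField.1
    ‹_›).2.2

end Valued.integer

end ProperSpace

section Normed

open scoped NormedField Valued
open IsLocalRing Polynomial

variable {K : Type*} [NontriviallyNormedField K] [IsUltrametricDist K] [ProperSpace K]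

theorem Valued.integer.residue_eq_zero_iff_norm_lt_one {K : Type*} [NontriviallyNormedField K]
    [IsUltrametricDist K] (x : 𝒪[K]) : residue 𝒪[K] x = 0 ↔ ‖(x : K)‖ < 1 := by
  rw [residue_eq_zero_iff, mem_maximalIdeal, mem_nonunits_iff, isUnit_iff_norm_eq_one]
  exact ⟨fun h ↦ lt_of_le_of_ne (mem_iff.1 x.2) h, fun h ↦ h.ne⟩

theorem Valued.integer.charP_residueField {K : Type*} [NontriviallyNormedField K]
    [IsUltrametricDist K] {p : ℕ} [Fact p.Prime] (hp : ‖(p : K)‖ < 1) :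
    CharP 𝓀[K] p := by
  have h := (residue_eq_zero_iff_norm_lt_one (K := K) (p : 𝒪[K])).2 (by simpa using hp)
  rw [map_natCast] at h
  exact ringChar.of_eq (((Nat.dvd_prime Fact.out).1 (ringChar.dvd h)).resolve_left
    CharP.ringChar_ne_one)

theorem IsPrimitiveRoot.mem_integer {K : Type*} [NontriviallyNormedField K]
    [IsUltrametricDist K] {n : ℕ} (hn : n ≠ 0) {ζ : K} (hζ : IsPrimitiveRoot ζ n) : ζ ∈ 𝒪[K] := by
  have h : ‖ζ‖ ^ n = 1 := by rw [← norm_pow, hζ.pow_eq_one, norm_one]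
  exact Valued.integer.mem_iff.2 ((pow_eq_one_iff_of_nonneg (norm_nonneg _) hn).1 h).le

theorem IsPrimitiveRoot.norm_one_sub_pow {K : Type*} [NontriviallyNormedField K]
    [IsUltrametricDist K] {p : ℕ} [Fact p.Prime] (hodd : Odd p) (hp : ‖(p : K)‖ < 1) {ζ : K}
    (hζ : IsPrimitiveRoot ζ p) : ‖1 - ζ‖ ^ (p - 1) = ‖(p : K)‖ := by
  have := Valued.integer.charP_residueField hp
  let z : 𝒪[K] := ⟨ζ, hζ.mem_integer (Nat.Prime.ne_zero Fact.out)⟩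
  have hz : IsPrimitiveRoot z p :=
    hζ.of_map_of_injective (f := 𝒪[K].subtype) Subtype.val_injective
  obtain ⟨-, ε, hε, h⟩ := hz.exists_eq_one_sub_pow_mul p hodd
  have hu : IsUnit ε := by
    rw [← residue_ne_zero_iff_isUnit, hε]
    exact neg_ne_zero.2 one_ne_zero
  have h' : (p : K) = (1 - ζ) ^ (p - 1) * ε := congrArg Subtype.val h
  have hε1 : ‖(ε : K)‖ = 1 := Valued.integer.isUnit_iff_norm_eq_one.1 hu
  rw [h', norm_mul, hε1, mul_one, norm_pow]

/-- An isometric automorphism of a `p`-adic field acts on units close enough to `1` through the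
cyclotomic character, up to `p`-th powers. -/
theorem exists_map_eq_pow_mul_pow_of_norm_le {p : ℕ} [Fact p.Prime] (hodd : Odd p)
    (hp : ‖(p : K)‖ < 1) {ζ : K} (hζ : IsPrimitiveRoot ζ p) (σ : K ≃+* K)
    (hσ : ∀ x, ‖σ x‖ = ‖x‖) {n : ℕ} (hn : σ ζ = ζ ^ n) {u : K}
    (hu : ‖u - 1‖ ≤ ‖(1 - ζ) ^ p‖) : ∃ y, y ≠ 0 ∧ σ u = u ^ n * y ^ p := by
  have hpp : p.Prime := Fact.out
  have := Valued.integer.henselianLocalRing_of_properSpace (K := K)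
  have := Valued.integer.finite_residueField_of_properSpace (K := K)
  have := Valued.integer.charP_residueField hp
  have hmem : ∀ x, x ∈ 𝒪[K] ↔ ‖x‖ ≤ 1 := fun x ↦ Valued.integer.mem_iff
  let τ : 𝒪[K] ≃+* 𝒪[K] :=
    { toFun x := ⟨σ x, by rw [hmem, hσ, ← hmem]; exact x.2⟩
      invFun x := ⟨σ.symm x, by rw [hmem, ← hσ, σ.apply_symm_apply, ← hmem]; exact x.2⟩
      left_inv x := by simp
      right_inv x := by simp
      map_mul' x y := by ext; simp
      map_add' x y := by ext; simp }
  let z : 𝒪[K] := ⟨ζ, hζ.mem_integer hpp.ne_zero⟩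
  have hz : IsPrimitiveRoot z p :=
    hζ.of_map_of_injective (f := 𝒪[K].subtype) Subtype.val_injective
  have hl0 : (1 - ζ) ^ p ≠ 0 := pow_ne_zero _ (sub_ne_zero.2 (hζ.ne_one hpp.one_lt).symm)
  let a : 𝒪[K] := ⟨(u - 1) / (1 - ζ) ^ p, by
    rw [hmem, norm_div, div_le_one (norm_pos_iff.2 hl0)]
    exact hu⟩
  obtain ⟨y, hy, h⟩ := HenselianLocalRing.exists_map_eq_pow_mul_pow p hodd hz τ (n := n)
    (Subtype.ext hn) a
  have hua : ((1 + (1 - z) ^ p * a : 𝒪[K]) : K) = u := by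
    change 1 + (1 - ζ) ^ p * ((u - 1) / (1 - ζ) ^ p) = u
    field_simp
    ring
  refine ⟨y, fun h0 ↦ hy.ne_zero (Subtype.ext h0), ?_⟩
  have h' := congrArg (Subtype.val) h
  change σ ((1 + (1 - z) ^ p * a : 𝒪[K]) : K) =
    ((1 + (1 - z) ^ p * a : 𝒪[K]) : K) ^ n * y ^ p at h'
  rwa [hua] at h'

theorem HenselianLocalRing.exists_pow_eq_one_add_of_isUnit {O : Type*} [CommRing O]
    [HenselianLocalRing O] {l : ℕ} (hl : IsUnit (l : O)) (hl0 : l ≠ 0) {m : O}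
    (hm : m ∈ maximalIdeal O) : ∃ y, y ^ l = 1 + m := by
  obtain ⟨y, hy, -⟩ := HenselianLocalRing.is_henselian (X ^ l - C (1 + m))
    (monic_X_pow_sub_C _ hl0) 1 (by simpa using hm) (by simpa [derivative_X_pow] using hl)
  exact ⟨y, by simpa [sub_eq_zero] using hy⟩

theorem apply_pow_of_apply_mul {K : Type*} [Field K] {w : K → ℤ}
    (hwmul : ∀ x y : K, x ≠ 0 → y ≠ 0 → w (x * y) = w x + w y) {y : K} (hy : y ≠ 0) (n : ℕ) :
    w (y ^ n) = n * w y := by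
  have hw1 : w 1 = 0 := by simpa using hwmul 1 1 one_ne_zero one_ne_zero
  induction n with
  | zero => simp [hw1]
  | succ n ih =>
    rw [pow_succ, hwmul _ _ (pow_ne_zero _ hy) hy, ih]
    push_cast
    ring

/-- A discrete valuation on a `p`-adic field which is positive at `p` is nonnegative on the
unit ball. -/
theorem apply_nonneg_of_norm_le_one {p : ℕ} [Fact p.Prime] (hp : ‖(p : K)‖ < 1) (hp0 : (p : K) ≠ 0)
    {w : K → ℤ} (hwmul : ∀ x y : K, x ≠ 0 → y ≠ 0 → w (x * y) = w x + w y)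
    (hwadd : ∀ x y : K, x ≠ 0 → y ≠ 0 → x + y ≠ 0 → min (w x) (w y) ≤ w (x + y))
    (hwp : 0 < w p) {x : K} (hx0 : x ≠ 0) (hx : ‖x‖ ≤ 1) : 0 ≤ w x := by
  have := Valued.integer.henselianLocalRing_of_properSpace (K := K)
  have := Valued.integer.charP_residueField hp
  have hwpow := fun {y : K} (hy : y ≠ 0) ↦ apply_pow_of_apply_mul hwmul hy
  have hw1 : w 1 = 0 := by simpa using hwpow one_ne_zero 0
  have hwneg : ∀ {y : K}, y ≠ 0 → w (-y) = w y := by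
    intro y hy
    have h1 : 2 * w (-1 : K) = 0 := by
      have h := hwpow (neg_ne_zero.2 (one_ne_zero (α := K))) 2
      rw [neg_one_sq, hw1, Nat.cast_two] at h
      exact h.symm
    rw [← neg_one_mul, hwmul _ _ (neg_ne_zero.2 one_ne_zero) hy]
    omega
  by_contra! hneg
  obtain ⟨l, hl, hlp⟩ := Nat.exists_infinite_primes (max (w p).toNat p + 1)
  obtain ⟨m, hm⟩ : ∃ m : ℕ, w p = m := ⟨(w p).toNat, by omega⟩
  let t : 𝒪[K] := p * ⟨x, Valued.integer.mem_iff.2 hx⟩ ^ (l * m)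
  have ht : t ∈ maximalIdeal 𝒪[K] := by
    rw [← residue_eq_zero_iff]
    rw [map_mul, map_natCast, CharP.cast_eq_zero, zero_mul]
  have hlu : IsUnit (l : 𝒪[K]) := by
    rw [← residue_ne_zero_iff_isUnit, map_natCast, Ne, CharP.cast_eq_zero_iff _ p,
      Nat.prime_dvd_prime_iff_eq Fact.out hlp]
    omega
  obtain ⟨y, hy⟩ := HenselianLocalRing.exists_pow_eq_one_add_of_isUnit hlu hlp.ne_zero ht
  have hyK : (y : K) ^ l = 1 + p * x ^ (l * m) := congrArg Subtype.val hy
  have hxk : x ^ (l * m) ≠ 0 := pow_ne_zero _ hx0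
  have hpx : (p : K) * x ^ (l * m) ≠ 0 := mul_ne_zero hp0 hxk
  have hwpx : w (p * x ^ (l * m)) = m + l * m * w x := by
    rw [hwmul _ _ hp0 hxk, hwpow hx0, hm]
    push_cast
    ring
  have hm0 : 0 < (m : ℤ) := hm ▸ hwp
  have hlt : w (p * x ^ (l * m)) < 0 := by
    have := hlp.two_le
    rw [hwpx]
    have h2 : (2 : ℤ) ≤ l := by exact_mod_cast this
    nlinarith [mul_pos (show (0 : ℤ) < l by omega) hm0, mul_nonneg
      (mul_pos (show (0 : ℤ) < l by omega) hm0).le (show 0 ≤ -1 - w x by omega)]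
  have hy0 : (y : K) ≠ 0 := by
    intro h0
    rw [h0, zero_pow hlp.ne_zero, eq_comm, add_comm, add_eq_zero_iff_eq_neg] at hyK
    rw [hyK, hwneg one_ne_zero, hw1] at hlt
    exact hlt.false
  have hsum : w (1 + p * x ^ (l * m)) = w (p * x ^ (l * m)) := by
    have hs0 : 1 + p * x ^ (l * m) ≠ 0 := hyK ▸ pow_ne_zero _ hy0
    have h1 := hwadd _ _ one_ne_zero hpx hs0
    have h2 := hwadd _ _ hs0 (neg_ne_zero.2 one_ne_zero) (by simpa using hpx)
    rw [hwneg one_ne_zero, show 1 + p * x ^ (l * m) + -1 = p * x ^ (l * m) by ring] at h2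
    omega
  have h := hwpow hy0 l
  rw [hyK, hsum, hwpx] at h
  have hdvd : (l : ℤ) ∣ m := ⟨w y - m * w x, by linear_combination h⟩
  have := Nat.le_of_dvd (by exact_mod_cast hm0) (Int.natCast_dvd_natCast.1 hdvd)
  omega

theorem norm_le_one_of_apply_nonneg {p : ℕ} [Fact p.Prime] (hp : ‖(p : K)‖ < 1) (hp0 : (p : K) ≠ 0)
    {w : K → ℤ} (hwmul : ∀ x y : K, x ≠ 0 → y ≠ 0 → w (x * y) = w x + w y)
    (hwadd : ∀ x y : K, x ≠ 0 → y ≠ 0 → x + y ≠ 0 → min (w x) (w y) ≤ w (x + y))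
    (hwp : 0 < w p) {x : K} (hx0 : x ≠ 0) (hx : 0 ≤ w x) : ‖x‖ ≤ 1 := by
  by_contra! hlt
  obtain ⟨n, hn⟩ := pow_unbounded_of_one_lt ‖(p : K)‖⁻¹ hlt
  have hxn : x ^ n ≠ 0 := pow_ne_zero _ hx0
  have hle : ‖((p : K) * x ^ n)⁻¹‖ ≤ 1 := by
    rw [norm_inv, norm_mul, norm_pow]
    refine inv_le_one_of_one_le₀ ?_
    rw [inv_lt_iff_one_lt_mul₀' (norm_pos_iff.2 hp0)] at hn
    exact hn.le
  have hpx : (p : K) * x ^ n ≠ 0 := mul_ne_zero hp0 hxn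
  have h := apply_nonneg_of_norm_le_one hp hp0 hwmul hwadd hwp (inv_ne_zero hpx) hle
  have hw1 : w 1 = 0 := by simpa using hwmul 1 1 one_ne_zero one_ne_zero
  have h1 := hwmul _ _ hpx (inv_ne_zero hpx)
  rw [mul_inv_cancel₀ hpx, hw1, hwmul _ _ hp0 hxn] at h1
  have h2 : 0 ≤ w (x ^ n) := by
    rw [apply_pow_of_apply_mul hwmul hx0]
    positivity
  omega

end Normed

/-- `Ū_{pe₁s} ⊆ V`: for every `u ∈ O_Kˣ` with `u ≡ 1 (mod 𝔓^{pe₁s})` and every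
`σ ∈ Δ = Gal(K|F)`, one has `σ(u)·u^{−ω(σ)} ∈ (Kˣ)ᵖ`. -/
theorem statement6 (p : ℕ) [hp : Fact p.Prime] (hodd : Odd p)
    (F : Type*) [Field F] [Algebra ℚ_[p] F] [FiniteDimensional ℚ_[p] F]
    (hreg : ¬ ∃ z : F, IsPrimitiveRoot z p)
    (K : Type*) [Field K] [Algebra F K]
    (ζ : K) (hζ : IsPrimitiveRoot ζ p)
    (hKgen : IntermediateField.adjoin F {ζ} = ⊤)
    (ω : (K ≃ₐ[F] K) → (ZMod p)ˣ)
    (hω : ∀ σ : K ≃ₐ[F] K, σ ζ = ζ ^ (ω σ : ZMod p).val)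
    (w : K → ℤ) (hw0 : w 0 = 0)
    (hwmul : ∀ x y : K, x ≠ 0 → y ≠ 0 → w (x * y) = w x + w y)
    (hwadd : ∀ x y : K, x ≠ 0 → y ≠ 0 → x + y ≠ 0 → min (w x) (w y) ≤ w (x + y))
    (hwsurj : ∃ π : K, π ≠ 0 ∧ w π = 1)
    (s : ℕ) (hs : 0 < s)
    (hsdvd : ∀ z : F, z ≠ 0 → (s : ℤ) ∣ w (algebraMap F K z))
    (hsval : ∃ z : F, z ≠ 0 ∧ w (algebraMap F K z) = (s : ℤ))
    (e : ℕ) (he : 0 < e) (hew : w (algebraMap F K (p : F)) = (e * s : ℕ))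
    (f : ℕ) (hf : 0 < f) (hef : e * f = Module.finrank ℚ_[p] F)
    (e1s : ℕ) (he1s : (p - 1) * e1s = e * s)
    :
    ∀ u : K, (u - 1 = 0 ∨ ((p * e1s : ℕ) : ℤ) ≤ w (u - 1)) →
      ∀ σ : K ≃ₐ[F] K, ∃ y : K, y ≠ 0 ∧ σ u = u ^ (ω σ : ZMod p).val * y ^ p := by
  have hpp : p.Prime := Fact.out
  let : Algebra ℚ_[p] K := ((algebraMap F K).comp (algebraMap ℚ_[p] F)).toAlgebra
  have : IsScalarTower ℚ_[p] F K := IsScalarTower.of_algebraMap_eq fun _ ↦ rfl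
  have hζint : IsIntegral F ζ :=
    IsIntegral.of_pow hpp.pos (by rw [hζ.pow_eq_one]; exact isIntegral_one)
  have : FiniteDimensional F K := by
    have := IntermediateField.adjoin.finiteDimensional hζint
    rw [hKgen] at this
    exact IntermediateField.topEquiv.toLinearEquiv.finiteDimensional
  have : FiniteDimensional ℚ_[p] K := FiniteDimensional.trans ℚ_[p] F K
  let : NontriviallyNormedField K := spectralNorm.nontriviallyNormedField ℚ_[p] K
  let : NormedSpace ℚ_[p] K := spectralNorm.normedSpace ℚ_[p] K
  have : ProperSpace K := FiniteDimensional.proper ℚ_[p] K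
  have : IsUltrametricDist K :=
    IsUltrametricDist.isUltrametricDist_of_isNonarchimedean_norm
      (isNonarchimedean_spectralNorm (K := ℚ_[p]) (L := K))
  have hp1 : ‖(p : K)‖ < 1 := by
    have h : ‖(p : K)‖ = ‖(p : ℚ_[p])‖ := by
      rw [← spectralNorm_extends (L := K) (p : ℚ_[p]), map_natCast]
      rfl
    rw [h]
    exact Padic.norm_p_lt_one
  have hp0 : (p : K) ≠ 0 := by
    rw [← map_natCast (algebraMap ℚ_[p] K)]
    exact (map_ne_zero _).2 (Nat.cast_ne_zero.2 hpp.ne_zero)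
  have hwp : w (p : K) = e * s := by
    rw [map_natCast] at hew
    exact_mod_cast hew
  have hwp0 : 0 < w (p : K) := by
    rw [hwp]
    positivity
  intro u hu σ
  refine exists_map_eq_pow_mul_pow_of_norm_le hodd hp1 hζ (σ : K ≃+* K)
    (fun x ↦ (spectralNorm_eq_of_equiv (σ.restrictScalars ℚ_[p]) x).symm) (hω σ) ?_
  rcases hu with hu | hu
  · rw [hu, norm_zero]
    exact norm_nonneg _
  rcases eq_or_ne (u - 1) 0 with hu0 | hu0
  · rw [hu0, norm_zero]
    exact norm_nonneg _
  have hpp0 : (p : K) ^ p ≠ 0 := pow_ne_zero _ hp0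
  have hup0 : (u - 1) ^ (p - 1) ≠ 0 := pow_ne_zero _ hu0
  have hw : 0 ≤ w ((u - 1) ^ (p - 1) / (p : K) ^ p) := by
    have h := hwmul _ _ (div_ne_zero hup0 hpp0) hpp0
    rw [div_mul_cancel₀ _ hpp0, apply_pow_of_apply_mul hwmul hu0,
      apply_pow_of_apply_mul hwmul hp0, hwp] at h
    have h1 : ((p - 1 : ℕ) : ℤ) * (p * e1s : ℕ) ≤ (p - 1 : ℕ) * w (u - 1) := by gcongr
    have h2 : ((p - 1 : ℕ) : ℤ) * e1s = e * s := by exact_mod_cast he1s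
    rw [← h2] at h
    push_cast at h1
    linarith
  have hle := norm_le_one_of_apply_nonneg hp1 hp0 hwmul hwadd hwp0 (div_ne_zero hup0 hpp0) hw
  rw [norm_div, div_le_one (norm_pos_iff.2 hpp0), norm_pow, norm_pow,
    ← hζ.norm_one_sub_pow hodd hp1, ← pow_mul, mul_comm (p - 1), pow_mul] at hle
  rw [norm_pow]
  exact le_of_pow_le_pow_left₀ (Nat.sub_ne_zero_of_lt hpp.one_lt) (by positivity) hle
end
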